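/- Let α, δ ∈ ℂ with α ≠ 0, δ ≠ 0, α ≠ 1 and δ ≠ 1, let β, γ ∈ ℂ, and define f(x) = αx + β and g(x) = δx + γ. Let c ∈ ℂ[x] be a polynomial such that c ≠ f^m as polynomials for every m ≥ 1 and c ≠ g^n as polynomials for every n ≥ 1. If the set of λ ∈ ℂ for which there exist integers m, n ≥ 1 with f^m(λ) = g^n(λ) and g^n(λ) = c(λ) is infinite, then f and g do not generate a free semigroup under composition, i.e. there exist two distinct nonempty finite words in the letters f and g whose composites are equal as functions ℂ → ℂ. -/

import Mathlib

namespace UnitEq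

section Algebra

variable {K : Type*} [Field K]

/-- The residue at `s = 0` of `1 / (s^a (s+p)^b (s+q)^c)`. -/
noncomputable def G (p q : K) : ℕ → ℕ → ℕ → K
  | 0, _, _ => 0
  | a + 1, b, c => PowerSeries.coeff a
      (((PowerSeries.C p + PowerSeries.X)⁻¹) ^ b * ((PowerSeries.C q + PowerSeries.X)⁻¹) ^ c)

lemma G_zero (p q : K) (b c : ℕ) : G p q 0 b c = 0 := rfl

lemma G_comm (p q : K) (a b c : ℕ) : G p q a b c = G q p a c b := by
  cases a with
  | zero => rfl
  | succ a => simp only [G]; rw [mul_comm]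

lemma lin_ne {p : K} (hp : p ≠ 0) :
    PowerSeries.constantCoeff (PowerSeries.C p + PowerSeries.X : PowerSeries K) ≠ 0 := by
  simpa using hp

lemma G_rec {p : K} (hp : p ≠ 0) (q : K) (a b c : ℕ) :
    G p q (a + 1) b c = G p q a (b + 1) c + p * G p q (a + 1) (b + 1) c := by
  set u : PowerSeries K := (PowerSeries.C p + PowerSeries.X)⁻¹ with hu
  set v : PowerSeries K := (PowerSeries.C q + PowerSeries.X)⁻¹ with hv
  have h1 : (PowerSeries.C p + PowerSeries.X) * u = 1 := PowerSeries.mul_inv_cancel _ (lin_ne hp)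
  have h2 : u ^ b * v ^ c = PowerSeries.X * (u ^ (b + 1) * v ^ c)
      + PowerSeries.C p * (u ^ (b + 1) * v ^ c) := by
    calc u ^ b * v ^ c = ((PowerSeries.C p + PowerSeries.X) * u) * (u ^ b * v ^ c) := by
          rw [h1, one_mul]
      _ = _ := by ring
  have h3 : G p q (a + 1) b c = PowerSeries.coeff a (u ^ b * v ^ c) := rfl
  rw [h3, h2, map_add, PowerSeries.coeff_C_mul]
  cases a with
  | zero => simp [G, hu, hv]
  | succ a => rw [PowerSeries.coeff_succ_X_mul]; rfl

lemma G_rec' {q : K} (hq : q ≠ 0) (p : K) (a b c : ℕ) :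
    G p q (a + 1) b c = G p q a b (c + 1) + q * G p q (a + 1) b (c + 1) := by
  rw [G_comm p q, G_comm p q, G_comm p q]
  exact G_rec hq p a c b

lemma deriv_inv_lin {p : K} (hp : p ≠ 0) :
    PowerSeries.derivative K ((PowerSeries.C p + PowerSeries.X)⁻¹ : PowerSeries K)
      = - ((PowerSeries.C p + PowerSeries.X)⁻¹) ^ 2 := by
  rw [PowerSeries.derivative_inv']
  simp

lemma G_ibp {p q : K} (hp : p ≠ 0) (hq : q ≠ 0) (a b c : ℕ) :
    a * G p q (a + 1) b c + b * G p q a (b + 1) c + c * G p q a b (c + 1) = 0 := by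
  cases a with
  | zero => simp [G]
  | succ a =>
    set u : PowerSeries K := (PowerSeries.C p + PowerSeries.X)⁻¹ with hu
    set v : PowerSeries K := (PowerSeries.C q + PowerSeries.X)⁻¹ with hv
    have hu' : PowerSeries.derivative K u = - u ^ 2 := deriv_inv_lin hp
    have hv' : PowerSeries.derivative K v = - v ^ 2 := deriv_inv_lin hq
    have key : PowerSeries.derivative K (u ^ b * v ^ c)
        + (b : PowerSeries K) * (u ^ (b + 1) * v ^ c)
        + (c : PowerSeries K) * (u ^ b * v ^ (c + 1)) = 0 := by
      rw [Derivation.leibniz, Derivation.leibniz_pow, Derivation.leibniz_pow, hu', hv']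
      simp only [smul_eq_mul, nsmul_eq_mul]
      rcases b with _ | b <;> rcases c with _ | c <;> simp <;> ring
    have h := congrArg (PowerSeries.coeff a) key
    rw [map_add, map_add, PowerSeries.coeff_derivative, map_zero] at h
    have hc : ∀ (n : ℕ) (f : PowerSeries K), PowerSeries.coeff a ((n : PowerSeries K) * f)
        = n * PowerSeries.coeff a f := by
      intro n f
      rw [← nsmul_eq_mul, map_nsmul, nsmul_eq_mul]
    rw [hc, hc] at h
    simp only [G]
    push_cast
    linear_combination h

lemma G_zero_zero (p q : K) (a : ℕ) : G p q a 0 0 = if a = 1 then 1 else 0 := by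
  cases a with
  | zero => simp [G]
  | succ a => simp [G, PowerSeries.coeff_one]

/-- The three residues. -/
noncomputable def R1 (x y z : K) (a b c : ℕ) : K := G (x - y) (x - z) a b c
noncomputable def R2 (x y z : K) (a b c : ℕ) : K := G (y - x) (y - z) b a c
noncomputable def R3 (x y z : K) (a b c : ℕ) : K := G (z - x) (z - y) c a b

/-- Systems of numbers satisfying the partial fraction recurrences. -/
structure PF (x y z : K) (F : ℕ → ℕ → ℕ → K) : Prop where
  r12 : ∀ a b c, F (a + 1) b c - F a (b + 1) c = (x - y) * F (a + 1) (b + 1) c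
  r13 : ∀ a b c, F (a + 1) b c - F a b (c + 1) = (x - z) * F (a + 1) b (c + 1)
  r23 : ∀ a b c, F a (b + 1) c - F a b (c + 1) = (y - z) * F a (b + 1) (c + 1)
  ibp : ∀ a b c, a * F (a + 1) b c + b * F a (b + 1) c + c * F a b (c + 1) = 0

lemma PF.comb {x y z : K} {F H : ℕ → ℕ → ℕ → K} (hF : PF x y z F) (hH : PF x y z H) (s t : K) :
    PF x y z (fun a b c => s * F a b c + t * H a b c) where
  r12 a b c := by linear_combination s * hF.r12 a b c + t * hH.r12 a b c
  r13 a b c := by linear_combination s * hF.r13 a b c + t * hH.r13 a b c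
  r23 a b c := by linear_combination s * hF.r23 a b c + t * hH.r23 a b c
  ibp a b c := by linear_combination s * hF.ibp a b c + t * hH.ibp a b c

lemma G_rec23 {p q : K} (hp : p ≠ 0) (hq : q ≠ 0) (a b c : ℕ) :
    G p q a (b + 1) c - G p q a b (c + 1) = (q - p) * G p q a (b + 1) (c + 1) := by
  cases a with
  | zero => simp [G]
  | succ a =>
    linear_combination G_rec' hq p a (b + 1) c - G_rec hp q a b (c + 1)

lemma PF_R1 {x y z : K} (hxy : x ≠ y) (hxz : x ≠ z) : PF x y z (R1 x y z) where
  r12 a b c := by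
    have := G_rec (sub_ne_zero.2 hxy) (x - z) a b c
    simp only [R1]; linear_combination this
  r13 a b c := by
    have := G_rec' (sub_ne_zero.2 hxz) (x - y) a b c
    simp only [R1]; linear_combination this
  r23 a b c := by
    have := G_rec23 (sub_ne_zero.2 hxy) (sub_ne_zero.2 hxz) a b c
    simp only [R1]; linear_combination this
  ibp a b c := G_ibp (sub_ne_zero.2 hxy) (sub_ne_zero.2 hxz) a b c

lemma PF_R2 {x y z : K} (hxy : x ≠ y) (hyz : y ≠ z) : PF x y z (R2 x y z) where
  r12 a b c := by
    have := G_rec (sub_ne_zero.2 hxy.symm) (y - z) b a c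
    simp only [R2]; linear_combination -this
  r13 a b c := by
    have := G_rec23 (sub_ne_zero.2 hxy.symm) (sub_ne_zero.2 hyz) b a c
    simp only [R2]; linear_combination this
  r23 a b c := by
    have := G_rec' (sub_ne_zero.2 hyz) (y - x) b a c
    simp only [R2]; linear_combination this
  ibp a b c := by
    have := G_ibp (sub_ne_zero.2 hxy.symm) (sub_ne_zero.2 hyz) b a c
    simp only [R2]; linear_combination this

lemma PF_R3 {x y z : K} (hxz : x ≠ z) (hyz : y ≠ z) : PF x y z (R3 x y z) where
  r12 a b c := by
    have := G_rec23 (sub_ne_zero.2 hxz.symm) (sub_ne_zero.2 hyz.symm) c a b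
    simp only [R3]; linear_combination this
  r13 a b c := by
    have := G_rec (sub_ne_zero.2 hxz.symm) (z - y) c a b
    simp only [R3]; linear_combination -this
  r23 a b c := by
    have := G_rec' (sub_ne_zero.2 hyz.symm) (z - x) c a b
    simp only [R3]; linear_combination -this
  ibp a b c := by
    have := G_ibp (sub_ne_zero.2 hxz.symm) (sub_ne_zero.2 hyz.symm) c a b
    simp only [R3]; linear_combination this

/-- The sum of the residues vanishes. -/
lemma sum_res {x y z : K} (hxy : x ≠ y) (hxz : x ≠ z) (hyz : y ≠ z) (n : ℕ) :
    ∀ a b c, a + b + c = n →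
      R1 x y z a b c + R2 x y z a b c + R3 x y z a b c = if n = 1 then 1 else 0 := by
  have hP : PF x y z (fun a b c => R1 x y z a b c + R2 x y z a b c + R3 x y z a b c) := by
    have h := ((PF_R1 hxy hxz).comb (PF_R2 hxy hyz) 1 1).comb (PF_R3 hxz hyz) 1 1
    simpa using h
  induction n with
  | zero =>
    intro a b c h
    obtain ⟨rfl, rfl, rfl⟩ : a = 0 ∧ b = 0 ∧ c = 0 := by omega
    simp [R1, R2, R3, G]
  | succ n ih =>
    intro a b c h
    set S := fun a b c => R1 x y z a b c + R2 x y z a b c + R3 x y z a b c with hS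
    change S a b c = _
    have ih' : ∀ a b c, a + b + c = n → S a b c = if n = 1 then 1 else 0 := ih
    have two : ∀ a b c, a + b + c = n + 1 → 2 ≤ n + 1 → ∀ d : K, d ≠ 0 → d * S a b c = 0 →
        S a b c = if n + 1 = 1 then 1 else 0 := by
      intro a b c _ h2 d hd h0
      rw [if_neg (by omega)]
      exact (mul_eq_zero.1 h0).resolve_left hd
    rcases a with _ | a
    · rcases b with _ | b
      · simp only [hS, R1, R2, R3, G_zero, zero_add, G_zero_zero]
        rw [← h]; simp
      · rcases c with _ | c
        · simp only [hS, R1, R2, R3, G_zero, zero_add, G_zero_zero]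
          rw [← h]; simp
        · refine two _ _ _ h (by omega) _ (sub_ne_zero.2 hyz) ?_
          rw [← hP.r23]
          change S _ _ _ - S _ _ _ = 0
          rw [ih' _ _ _ (by omega), ih' _ _ _ (by omega), sub_self]
    · rcases b with _ | b
      · rcases c with _ | c
        · simp only [hS, R1, R2, R3, G_zero_zero, G_zero]
          rw [← h]; simp
        · refine two _ _ _ h (by omega) _ (sub_ne_zero.2 hxz) ?_
          rw [← hP.r13]
          change S _ _ _ - S _ _ _ = 0
          rw [ih' _ _ _ (by omega), ih' _ _ _ (by omega), sub_self]
      · refine two _ _ _ h (by omega) _ (sub_ne_zero.2 hxy) ?_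
        rw [← hP.r12]
        change S _ _ _ - S _ _ _ = 0
        rw [ih' _ _ _ (by omega), ih' _ _ _ (by omega), sub_self]

/-- Descent used for the non-vanishing of one of two contiguous determinants. -/
lemma PF.descent [CharZero K] {x y z : K}
    {F : ℕ → ℕ → ℕ → K} (hF : PF x y z F) (h0 : F 1 0 1 ≠ 0) (n : ℕ) :
    ∀ a b c, a + b + c = n → F (a + 1) (b + 1) (c + 1) = 0 → F (a + 1) (b + 1) c = 0 → False := by
  induction n with
  | zero =>
    intro a b c h h1 h2
    obtain ⟨rfl, rfl, rfl⟩ : a = 0 ∧ b = 0 ∧ c = 0 := by omega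
    have := hF.r23 1 0 0
    simp only [zero_add] at this h1 h2
    rw [h1, h2] at this
    apply h0
    linear_combination -this
  | succ n ih =>
    intro a b c h h1 h2
    have e1 : F (a + 1) b (c + 1) = 0 := by
      have := hF.r23 (a + 1) b c
      rw [h1, h2] at this; linear_combination -this
    have e2 : F a (b + 1) (c + 1) = 0 := by
      have := hF.r13 a (b + 1) c
      rw [h1, h2] at this; linear_combination -this
    have g1 := hF.r23 a b c
    have g2 := hF.r13 a b c
    have g3 := hF.ibp a b c
    rw [e2] at g1
    rw [e1] at g2
    have hs : ((a + b + c : ℕ) : K) * F a b (c + 1) = 0 := by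
      push_cast
      linear_combination g3 - b * g1 - a * g2
    have k1 : F a b (c + 1) = 0 := by
      rcases mul_eq_zero.1 hs with h' | h'
      · rw [h] at h'; exact absurd h' (by exact_mod_cast Nat.succ_ne_zero n)
      · exact h'
    have k2 : F a (b + 1) c = 0 := by linear_combination g1 + k1
    have k3 : F (a + 1) b c = 0 := by linear_combination g2 + k1
    rcases a with _ | a
    · rcases b with _ | b
      · rcases c with _ | c
        · omega
        · refine ih 0 0 c (by omega) h2 ?_
          have := hF.r23 1 0 c
          simp only [zero_add] at this k3 h2 ⊢
          rw [h2, k3] at this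
          linear_combination this
      · exact ih 0 b c (by omega) e1 k3
    · exact ih a b c (by omega) e2 k2

/-- Integrality and size of normalized residues. -/
lemma G_bound {p q : K} (hp : p ≠ 0) (hq : q ≠ 0) (O : Subring K) (hpO : p ∈ O) (hqO : q ∈ O)
    (w : AbsoluteValue K ℝ) (M : ℝ) (hM : 1 ≤ M) (hpM : w p ≤ M) (hqM : w q ≤ M) (n : ℕ) :
    ∀ a b c, a + b + c = n →
      G p q a b c * p ^ (a + b - 1) * q ^ (a + c - 1) ∈ O ∧
      w (G p q a b c * p ^ (a + b - 1) * q ^ (a + c - 1)) ≤ 2 ^ n * M ^ a := by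
  induction n with
  | zero =>
    intro a b c h
    obtain ⟨rfl, rfl, rfl⟩ : a = 0 ∧ b = 0 ∧ c = 0 := by omega
    simp [G, O.zero_mem]
  | succ n ih =>
    intro a b c h
    have hM0 : (0:ℝ) ≤ M := by linarith
    have hMp : ∀ k, 1 ≤ M ^ k := fun k => one_le_pow₀ hM
    have h2p : ∀ k, (1:ℝ) ≤ 2 ^ k := fun k => one_le_pow₀ (by norm_num)
    have step : ∀ (u v r : K) (k : ℕ), r ∈ O → w r ≤ M → (u ∈ O ∧ w u ≤ 2 ^ n * M ^ (k + 1)) →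
        (v ∈ O ∧ w v ≤ 2 ^ n * M ^ k) →
        (u - r * v ∈ O ∧ w (u - r * v) ≤ 2 ^ (n + 1) * M ^ (k + 1)) := by
      intro u v r k hr hrM hu hv
      refine ⟨O.sub_mem hu.1 (O.mul_mem hr hv.1), ?_⟩
      calc w (u - r * v) ≤ w u + w (r * v) := by
            have := w.add_le u (-(r * v))
            rwa [← sub_eq_add_neg, w.map_neg] at this
        _ ≤ 2 ^ n * M ^ (k + 1) + M * (2 ^ n * M ^ k) := by
            rw [w.map_mul]
            exact add_le_add hu.2 (mul_le_mul hrM hv.2 (w.nonneg _) hM0)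
        _ = _ := by ring
    rcases a with _ | a
    · simp [G_zero, O.zero_mem]
    · rcases b with _ | b
      · rcases c with _ | c
        · rw [G_zero_zero]
          by_cases ha : a = 0
          · subst ha
            simp [O.one_mem]
            nlinarith [h2p (n + 1)]
          · simp [ha, O.zero_mem]
            positivity
        · have hr := G_rec' hq p a 0 c
          have i1 := ih (a + 1) 0 c (by omega)
          have i2 := ih a 0 (c + 1) (by omega)
          have s := step _ _ p a hpO hpM i1 i2
          have e : G p q (a + 1) 0 c * p ^ (a + 1 + 0 - 1) * q ^ (a + 1 + c - 1)
              - p * (G p q a 0 (c + 1) * p ^ (a + 0 - 1) * q ^ (a + (c + 1) - 1))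
              = G p q (a + 1) 0 (c + 1) * p ^ (a + 1 + 0 - 1) * q ^ (a + 1 + (c + 1) - 1) := by
            have e1 : a + 1 + c - 1 = a + c := by omega
            have e2 : a + (c + 1) - 1 = a + c := by omega
            have e3 : a + 1 + (c + 1) - 1 = a + c + 1 := by omega
            rw [e1, e2, e3, hr]
            rcases a with _ | a
            · simp only [G_zero]; ring
            · simp only [Nat.add_sub_cancel, add_zero]; ring
          rwa [e] at s
      · have hr := G_rec hp q a b c
        have i1 := ih (a + 1) b c (by omega)
        have i2 := ih a (b + 1) c (by omega)
        have s := step _ _ q a hqO hqM i1 i2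
        have e : G p q (a + 1) b c * p ^ (a + 1 + b - 1) * q ^ (a + 1 + c - 1)
            - q * (G p q a (b + 1) c * p ^ (a + (b + 1) - 1) * q ^ (a + c - 1))
            = G p q (a + 1) (b + 1) c * p ^ (a + 1 + (b + 1) - 1) * q ^ (a + 1 + c - 1) := by
          have e1 : a + 1 + b - 1 = a + b := by omega
          have e2 : a + (b + 1) - 1 = a + b := by omega
          have e3 : a + 1 + (b + 1) - 1 = a + b + 1 := by omega
          have e4 : a + 1 + c - 1 = a + c := by omega
          rw [e1, e2, e3, e4, hr]
          rcases a with _ | a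
          · simp only [G_zero]; ring
          · have e5 : a + 1 + c - 1 = a + c := by omega
            rw [e5]; ring
        rwa [e] at s

end Algebra

end UnitEq
namespace UnitEq

section Pade

variable {K : Type*} [Field K]

lemma pade_aux {X Y : K} (hX : X ≠ 0) (hY : Y ≠ 0) (hXY : X + Y = 1) (O : Subring K)
    (hXO : X ∈ O) (hYO : Y ∈ O) (N c : ℕ) (hc : c ≤ N + 1) (hN : 1 ≤ N) :
    ∃ P1 P2 P3 : K, P1 ∈ O ∧ P2 ∈ O ∧ P3 ∈ O ∧
      (∀ (w : AbsoluteValue K ℝ) (M : ℝ), 1 ≤ M → w X ≤ M → w Y ≤ M →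
        w P1 ≤ 2 ^ (3 * N + 3) * M ^ (N + 1) ∧ w P2 ≤ 2 ^ (3 * N + 3) * M ^ (N + 1) ∧
        w P3 ≤ 2 ^ (3 * N + 3) * M ^ (N + 1)) ∧
      X ^ (N + c) * P1 + Y ^ (N + c) * P2 = P3 ∧
      P1 = Y ^ (N + c) * R1 0 1 Y (N + 1) (N + 1) c ∧
      P2 = X ^ (N + c) * R2 0 1 Y (N + 1) (N + 1) c := by
  classical
  have hX' : X = 1 - Y := by linear_combination hXY
  have h1Y : (1 : K) ≠ Y := fun h => hX (by rw [hX', ← h, sub_self])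
  have hsum := sum_res (x := (0:K)) (y := 1) (z := Y) zero_ne_one hY.symm h1Y _
    (N + 1) (N + 1) c rfl
  rw [if_neg (by omega)] at hsum
  have hm1 : (0 : K) - 1 ≠ 0 := by simp
  have h0Y : (0 : K) - Y ≠ 0 := by simpa using hY
  have h10 : (1 : K) - 0 ≠ 0 := by simp
  have h1Y' : (1 : K) - Y ≠ 0 := sub_ne_zero.2 h1Y
  have hY0 : Y - 0 ≠ 0 := by simpa using hY
  have hY1 : Y - 1 ≠ 0 := sub_ne_zero.2 h1Y.symm
  have hneg : ∀ k : ℕ, ((-1 : K)) ^ k ∈ O := fun k => O.pow_mem (O.neg_mem O.one_mem) k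
  have hwneg : ∀ (w : AbsoluteValue K ℝ) (k : ℕ), w ((-1 : K) ^ k) = 1 := by
    intro w k; rw [map_pow, w.map_neg, w.map_one, one_pow]
  have sq1 : ∀ k : ℕ, ((-1 : K)) ^ k * (-1) ^ k = 1 := by
    intro k; rw [← mul_pow]; simp
  -- first
  have b1 := fun (w : AbsoluteValue K ℝ) (M : ℝ) (hM : 1 ≤ M) (hwX : w X ≤ M) (hwY : w Y ≤ M) =>
    G_bound hm1 h0Y O (by simpa using O.neg_mem O.one_mem) (by simpa using hYO) w M hM
      (by simpa using hM) (by simpa using hwY) _ (N + 1) (N + 1) c rfl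
  have b2 := fun (w : AbsoluteValue K ℝ) (M : ℝ) (hM : 1 ≤ M) (hwX : w X ≤ M) (hwY : w Y ≤ M) =>
    G_bound h10 h1Y' O (by simpa using O.one_mem) (by simpa [← hX'] using hXO) w M hM
      (by simpa using hM) (by simpa [← hX'] using hwX) _ (N + 1) (N + 1) c rfl
  have b3 := fun (w : AbsoluteValue K ℝ) (M : ℝ) (hM : 1 ≤ M) (hwX : w X ≤ M) (hwY : w Y ≤ M) =>
    G_bound hY0 hY1 O (by simpa using hYO) (by
        have : Y - 1 = -X := by rw [hX']; ring
        rw [this]; exact O.neg_mem hXO) w M hM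
      (by simpa using hwY) (by
        have : Y - 1 = -X := by rw [hX']; ring
        rw [this, w.map_neg]; exact hwX) _ c (N + 1) (N + 1) rfl
  set Q1 := G (0 - 1) (0 - Y) (N + 1) (N + 1) c * (0 - 1) ^ (N + 1 + (N + 1) - 1) *
    (0 - Y) ^ (N + 1 + c - 1) with hQ1
  set Q2 := G (1 - 0) (1 - Y) (N + 1) (N + 1) c * (1 - 0) ^ (N + 1 + (N + 1) - 1) *
    (1 - Y) ^ (N + 1 + c - 1) with hQ2
  set Q3 := G (Y - 0) (Y - 1) c (N + 1) (N + 1) * (Y - 0) ^ (c + (N + 1) - 1) *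
    (Y - 1) ^ (c + (N + 1) - 1) with hQ3
  have i1 : N + 1 + (N + 1) - 1 = 2 * N + 1 := by omega
  have i2 : N + 1 + c - 1 = N + c := by omega
  have i3 : c + (N + 1) - 1 = N + c := by omega
  have r1 : Y ^ (N + c) * R1 0 1 Y (N + 1) (N + 1) c = -((-1) ^ (N + c) * Q1) := by
    rw [hQ1, i1, i2, R1]
    have e1 : ((0:K) - 1) ^ (2 * N + 1) = -1 := by
      rw [zero_sub, pow_succ, pow_mul]; simp
    have e2 : ((0:K) - Y) ^ (N + c) = (-1) ^ (N + c) * Y ^ (N + c) := by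
      rw [← mul_pow]; simp
    rw [e1, e2]
    linear_combination (-(Y ^ (N + c) * G (0 - 1) (0 - Y) (N + 1) (N + 1) c)) * sq1 (N + c)
  have r2 : X ^ (N + c) * R2 0 1 Y (N + 1) (N + 1) c = Q2 := by
    rw [hQ2, i1, i2, R2, ← hX']
    simp; ring
  have r3 : X ^ (N + c) * Y ^ (N + c) * R3 0 1 Y (N + 1) (N + 1) c = (-1) ^ (N + c) * Q3 := by
    rw [hQ3, i3, R3]
    have e2 : (Y - 1) ^ (N + c) = (-1) ^ (N + c) * X ^ (N + c) := by
      rw [← mul_pow, hX']; congr 1; ring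
    have e3 : (Y - 0) ^ (N + c) = Y ^ (N + c) := by rw [sub_zero]
    rw [e2, e3]
    linear_combination (-(X ^ (N + c) * Y ^ (N + c) * G (Y - 0) (Y - 1) c (N + 1) (N + 1)))
      * sq1 (N + c)
  have hbd : ∀ (M : ℝ) (n k : ℕ), 1 ≤ M → n ≤ 3 * N + 3 → k ≤ N + 1 →
      (2 : ℝ) ^ n * M ^ k ≤ 2 ^ (3 * N + 3) * M ^ (N + 1) := by
    intro M n k hM hn hk
    exact mul_le_mul (pow_le_pow_right₀ (by norm_num) hn) (pow_le_pow_right₀ hM hk)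
      (by positivity) (by positivity)
  have htriv : ∀ x : K, (AbsoluteValue.trivial (R := K) (S := ℝ)) x ≤ 1 := by
    intro x
    by_cases hx : x = 0 <;> simp [hx]
  have hO1 : Q1 ∈ O := (b1 AbsoluteValue.trivial 1 le_rfl (htriv _) (htriv _)).1
  have hO2 : Q2 ∈ O := (b2 AbsoluteValue.trivial 1 le_rfl (htriv _) (htriv _)).1
  have hO3 : Q3 ∈ O := (b3 AbsoluteValue.trivial 1 le_rfl (htriv _) (htriv _)).1
  refine ⟨-((-1) ^ (N + c) * Q1), Q2, -((-1) ^ (N + c) * Q3),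
    O.neg_mem (O.mul_mem (hneg _) hO1), hO2, O.neg_mem (O.mul_mem (hneg _) hO3), ?_, ?_,
    r1.symm, r2.symm⟩
  · intro w M hM hwX hwY
    refine ⟨?_, ?_, ?_⟩
    · rw [w.map_neg, map_mul, hwneg, one_mul]
      exact (b1 w M hM hwX hwY).2.trans (hbd M _ _ hM (by omega) (by omega))
    · exact (b2 w M hM hwX hwY).2.trans (hbd M _ _ hM (by omega) (by omega))
    · rw [w.map_neg, map_mul, hwneg, one_mul]
      exact (b3 w M hM hwX hwY).2.trans (hbd M _ _ hM (by omega) (by omega))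
  · rw [← r1, ← r2, ← r3]
    linear_combination X ^ (N + c) * Y ^ (N + c) * hsum

lemma pade [CharZero K] {X Y : K} (hX : X ≠ 0) (hY : Y ≠ 0) (hXY : X + Y = 1) (O : Subring K)
    (hXO : X ∈ O) (hYO : Y ∈ O) {x y : K} (hy : y ≠ 0) (N : ℕ) (hN : 1 ≤ N) :
    ∃ (e : ℕ) (P1 P2 P3 : K), 2 * N ≤ e ∧ e ≤ 2 * N + 1 ∧ P1 ∈ O ∧ P2 ∈ O ∧ P3 ∈ O ∧
      (∀ (w : AbsoluteValue K ℝ) (M : ℝ), 1 ≤ M → w X ≤ M → w Y ≤ M →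
        w P1 ≤ 2 ^ (3 * N + 3) * M ^ (N + 1) ∧ w P2 ≤ 2 ^ (3 * N + 3) * M ^ (N + 1) ∧
        w P3 ≤ 2 ^ (3 * N + 3) * M ^ (N + 1)) ∧
      X ^ e * P1 + Y ^ e * P2 = P3 ∧
      X ^ e * P1 * y - Y ^ e * P2 * x ≠ 0 := by
  have hX' : X = 1 - Y := by linear_combination hXY
  have h1Y : (1 : K) ≠ Y := fun h => hX (by rw [hX', ← h, sub_self])
  have hF : PF 0 1 Y (fun a b c => y * R1 0 1 Y a b c + (-x) * R2 0 1 Y a b c) :=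
    (PF_R1 zero_ne_one hY.symm).comb (PF_R2 zero_ne_one h1Y) y (-x)
  have h0 : y * R1 0 1 Y 1 0 1 + (-x) * R2 0 1 Y 1 0 1 ≠ 0 := by
    have : R1 0 1 Y 1 0 1 = (0 - Y)⁻¹ := by
      simp [R1, G]
    have h2 : R2 0 1 Y 1 0 1 = 0 := rfl
    rw [this, h2]
    simp [hy, hY]
  have hex : ∃ c, N ≤ c ∧ c ≤ N + 1 ∧
      y * R1 0 1 Y (N + 1) (N + 1) c + (-x) * R2 0 1 Y (N + 1) (N + 1) c ≠ 0 := by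
    by_contra hcon
    push Not at hcon
    exact hF.descent h0 _ N N N rfl (hcon (N + 1) (by omega) le_rfl) (hcon N le_rfl (by omega))
  obtain ⟨c, hc1, hc2, hne⟩ := hex
  obtain ⟨P1, P2, P3, h1, h2, h3, hb, hs, e1, e2⟩ := pade_aux hX hY hXY O hXO hYO N c hc2 hN
  refine ⟨N + c, P1, P2, P3, by omega, by omega, h1, h2, h3, hb, hs, ?_⟩
  have : X ^ (N + c) * P1 * y - Y ^ (N + c) * P2 * x = X ^ (N + c) * Y ^ (N + c) *
      (y * R1 0 1 Y (N + 1) (N + 1) c + (-x) * R2 0 1 Y (N + 1) (N + 1) c) := by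
    rw [e1, e2]; ring
  rw [this]
  exact mul_ne_zero (mul_ne_zero (pow_ne_zero _ hX) (pow_ne_zero _ hY)) hne

end Pade

end UnitEq
namespace UnitEq

section Dioph

open Real

variable {K : Type*} [Field K] {ι : Type*} [Fintype ι]

lemma log_max_le {a b : ℝ} (ha : 0 < a) (hb : 0 < b) :
    log (max 1 (max a b)) ≤ |log a| + |log b| := by
  rcases max_choice 1 (max a b) with h | h
  · rw [h, log_one]; positivity
  · rw [h]
    rcases max_choice a b with h | h
    · rw [h]; linarith [le_abs_self (log a), abs_nonneg (log b)]
    · rw [h]; linarith [le_abs_self (log b), abs_nonneg (log a)]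

lemma sum_log_unit (O : Subring K) (w : ι → AbsoluteValue K ℝ) (k : ι → ℝ)
    (hprod : ∀ x ∈ O, x ≠ 0 → 0 ≤ ∑ i, k i * log (w i x)) {u : K} (hu : u ∈ O) (hu' : u⁻¹ ∈ O)
    (h0 : u ≠ 0) : ∑ i, k i * log (w i u) = 0 := by
  have h1 := hprod u hu h0
  have h2 := hprod u⁻¹ hu' (inv_ne_zero h0)
  simp only [map_inv₀, log_inv, mul_neg, Finset.sum_neg_distrib] at h2
  linarith

lemma main_ineq [CharZero K] (O : Subring K) (w : ι → AbsoluteValue K ℝ) (k : ι → ℝ)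
    (hk : ∀ i, 0 ≤ k i)
    (hprod : ∀ x ∈ O, x ≠ 0 → 0 ≤ ∑ i, k i * log (w i x))
    {X Y x y : K} (hX : X ≠ 0) (hY : Y ≠ 0) (hXY : X + Y = 1) (hXO : X ∈ O) (hYO : Y ∈ O)
    (hXO' : X⁻¹ ∈ O) (hYO' : Y⁻¹ ∈ O) (hx : x ≠ 0) (hy : y ≠ 0) (hxy : x + y = 1)
    (hxO : x ∈ O) (hyO : y ∈ O) (N : ℕ) (hN : 1 ≤ N) :
    ∃ e : ℕ, 2 * N ≤ e ∧ e ≤ 2 * N + 1 ∧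
      ((e : ℝ) - (N + 1)) * ∑ i, k i * log (max 1 (max (w i X) (w i Y))) ≤
        (∑ i, k i) * ((3 * N + 4) * log 2) +
        ∑ i, k i * (|log (w i x) - e * log (w i X)| + |log (w i y) - e * log (w i Y)|) := by
  obtain ⟨e, P1, P2, P3, he1, he2, h1, h2, h3, hb, hs, hne⟩ :=
    pade hX hY hXY O hXO hYO (x := x) hy N hN
  refine ⟨e, he1, he2, ?_⟩
  have hXe : X ^ e ≠ 0 := pow_ne_zero _ hX
  have hYe : Y ^ e ≠ 0 := pow_ne_zero _ hY
  set u := x * (X⁻¹) ^ e with hu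
  set v := y * (Y⁻¹) ^ e with hv
  have hu1 : X ^ e * u = x := by rw [hu, inv_pow]; field_simp
  have hv1 : Y ^ e * v = y := by rw [hv, inv_pow]; field_simp
  have hu0 : u ≠ 0 := mul_ne_zero hx (pow_ne_zero _ (inv_ne_zero hX))
  have hv0 : v ≠ 0 := mul_ne_zero hy (pow_ne_zero _ (inv_ne_zero hY))
  set D := P1 * v - P2 * u with hD
  have hD0 : D ≠ 0 := by
    intro h
    apply hne
    have : X ^ e * P1 * y - Y ^ e * P2 * x = X ^ e * Y ^ e * D := by
      rw [hD, ← hu1, ← hv1]; ring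
    rw [this, h, mul_zero]
  have hDO : D ∈ O := O.sub_mem
    (O.mul_mem h1 (O.mul_mem hyO (O.pow_mem hYO' _)))
    (O.mul_mem h2 (O.mul_mem hxO (O.pow_mem hXO' _)))
  have hDX : X ^ e * D = P3 * v - P2 := by
    rw [hD]
    linear_combination (-P2) * hu1 - P2 * hv1 + v * hs - P2 * hxy
  have hDY : Y ^ e * D = P1 - P3 * u := by
    rw [hD]
    linear_combination P1 * hv1 - u * hs + P1 * hu1 + P1 * hxy
  have hpt : ∀ i, log (w i D) ≤ (3 * N + 4) * log 2 +
      ((N + 1) - e) * log (max 1 (max (w i X) (w i Y))) +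
      (|log (w i x) - e * log (w i X)| + |log (w i y) - e * log (w i Y)|) := by
    intro i
    set M := max 1 (max (w i X) (w i Y)) with hM
    have hM1 : 1 ≤ M := le_max_left _ _
    have hMX : w i X ≤ M := (le_max_left _ _).trans (le_max_right _ _)
    have hMY : w i Y ≤ M := (le_max_right _ _).trans (le_max_right _ _)
    obtain ⟨hb1, hb2, hb3⟩ := hb (w i) M hM1 hMX hMY
    set B := (2 : ℝ) ^ (3 * N + 3) * M ^ (N + 1) with hB
    set U := max 1 (max (w i u) (w i v)) with hU
    have hU1 : 1 ≤ U := le_max_left _ _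
    have hUu : w i u ≤ U := (le_max_left _ _).trans (le_max_right _ _)
    have hUv : w i v ≤ U := (le_max_right _ _).trans (le_max_right _ _)
    have hB0 : 0 ≤ B := by positivity
    have sub_le' : ∀ a b : K, w i (a - b) ≤ w i a + w i b := by
      intro a b
      have := (w i).add_le a (-b)
      rwa [← sub_eq_add_neg, (w i).map_neg] at this
    have two : ∀ p q r s : K, w i p ≤ B → w i q ≤ U → w i r ≤ B → w i s ≤ U →
        w i (p * q - r * s) ≤ 2 * B * U := by
      intro p q r s hp hq hr hs
      have a1 : w i (p * q) ≤ B * U := by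
        rw [map_mul]; exact mul_le_mul hp hq ((w i).nonneg _) hB0
      have a2 : w i (r * s) ≤ B * U := by
        rw [map_mul]; exact mul_le_mul hr hs ((w i).nonneg _) hB0
      linarith [sub_le' (p * q) (r * s)]
    have one' : w i 1 ≤ U := by rw [map_one]; exact hU1
    have hDM : M ^ e * w i D ≤ 2 * B * U := by
      rcases max_choice 1 (max (w i X) (w i Y)) with h | h
      · rw [hM, h, one_pow, one_mul]
        exact two _ _ _ _ hb1 hUv hb2 hUu
      · rcases max_choice (w i X) (w i Y) with h' | h'
        · rw [hM, h, h', ← map_pow, ← map_mul, hDX]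
          have := two P3 v P2 1 hb3 hUv hb2 one'
          rwa [mul_one] at this
        · rw [hM, h, h', ← map_pow, ← map_mul, hDY]
          have := two P1 1 P3 u hb1 one' hb3 hUu
          rwa [mul_one] at this
    have hM0 : 0 < M := by linarith
    have hwD : 0 < w i D := (w i).pos hD0
    have hl := log_le_log (by positivity) hDM
    have hl1 : log (M ^ e * w i D) = e * log M + log (w i D) := by
      rw [log_mul (by positivity) hwD.ne', log_pow]
    have hl2 : log (2 * B * U) = (3 * N + 4) * log 2 + (N + 1) * log M + log U := by
      rw [hB, log_mul (by positivity) (by positivity), log_mul (by norm_num) (by positivity),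
        log_mul (by positivity) (by positivity), log_pow, log_pow]
      push_cast; ring
    have hl3 := log_max_le ((w i).pos hu0) ((w i).pos hv0)
    have hlu : log (w i u) = log (w i x) - e * log (w i X) := by
      rw [hu, map_mul, map_pow, map_inv₀, log_mul ((w i).pos hx).ne'
        (pow_ne_zero _ (inv_ne_zero ((w i).pos hX).ne')), log_pow, log_inv]; ring
    have hlv : log (w i v) = log (w i y) - e * log (w i Y) := by
      rw [hv, map_mul, map_pow, map_inv₀, log_mul ((w i).pos hy).ne'
        (pow_ne_zero _ (inv_ne_zero ((w i).pos hY).ne')), log_pow, log_inv]; ring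
    rw [hlu, hlv] at hl3
    rw [hl1, hl2] at hl
    linarith
  have h0 := hprod D hDO hD0
  have hsum : ∑ i, k i * log (w i D) ≤ ∑ i, k i * ((3 * N + 4) * log 2 +
      ((N + 1) - e) * log (max 1 (max (w i X) (w i Y))) +
      (|log (w i x) - e * log (w i X)| + |log (w i y) - e * log (w i Y)|)) :=
    Finset.sum_le_sum fun i _ => mul_le_mul_of_nonneg_left (hpt i) (hk i)
  have hexp : ∑ i, k i * ((3 * N + 4) * log 2 +
      ((N + 1) - e) * log (max 1 (max (w i X) (w i Y))) +
      (|log (w i x) - e * log (w i X)| + |log (w i y) - e * log (w i Y)|)) =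
      (∑ i, k i) * ((3 * N + 4) * log 2)
      + ((N + 1) - e) * ∑ i, k i * log (max 1 (max (w i X) (w i Y)))
      + ∑ i, k i * (|log (w i x) - e * log (w i X)| + |log (w i y) - e * log (w i Y)|) := by
    rw [Finset.sum_mul, Finset.mul_sum, ← Finset.sum_add_distrib, ← Finset.sum_add_distrib]
    exact Finset.sum_congr rfl fun i _ => by ring
  rw [hexp] at hsum
  linarith

/-- The size of an element. -/
noncomputable def sz (w : ι → AbsoluteValue K ℝ) (k : ι → ℝ) (x : K) : ℝ :=
  ∑ i, |k i * log (w i x)|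

lemma sz_le (O : Subring K) (w : ι → AbsoluteValue K ℝ) (k : ι → ℝ)
    (hk : ∀ i, 0 ≤ k i)
    (hprod : ∀ x ∈ O, x ≠ 0 → 0 ≤ ∑ i, k i * log (w i x))
    {X : K} (hX : X ≠ 0) (hXO : X ∈ O) (hXO' : X⁻¹ ∈ O) (M : ι → ℝ)
    (hM : ∀ i, 1 ≤ M i) (hMX : ∀ i, w i X ≤ M i) :
    sz w k X ≤ 2 * ∑ i, k i * log (M i) := by
  have h0 := sum_log_unit O w k hprod hXO hXO' hX
  have : sz w k X = ∑ i, (|k i * log (w i X)| + k i * log (w i X)) := by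
    rw [Finset.sum_add_distrib, h0, add_zero]; rfl
  rw [this, Finset.mul_sum]
  refine Finset.sum_le_sum fun i _ => ?_
  have h1 : k i * log (w i X) ≤ k i * log (M i) :=
    mul_le_mul_of_nonneg_left (log_le_log ((w i).pos hX) (hMX i)) (hk i)
  have h2 : 0 ≤ k i * log (M i) := mul_nonneg (hk i) (log_nonneg (hM i))
  rcases abs_choice (k i * log (w i X)) with h | h <;> rw [h] <;> linarith

theorem unit_eq_finite [CharZero K] (O : Subring K) (w : ι → AbsoluteValue K ℝ) (k : ι → ℝ)
    (hk : ∀ i, 0 ≤ k i)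
    (hprod : ∀ x ∈ O, x ≠ 0 → 0 ≤ ∑ i, k i * log (w i x))
    (hnorth : ∀ B : ℝ, {x : K | x ≠ 0 ∧ x ∈ O ∧ x⁻¹ ∈ O ∧ sz w k x ≤ B}.Finite) :
    {x : K | x ≠ 0 ∧ 1 - x ≠ 0 ∧ x ∈ O ∧ x⁻¹ ∈ O ∧ 1 - x ∈ O ∧ (1 - x)⁻¹ ∈ O}.Finite := by
  set E := {x : K | x ≠ 0 ∧ 1 - x ≠ 0 ∧ x ∈ O ∧ x⁻¹ ∈ O ∧ 1 - x ∈ O ∧ (1 - x)⁻¹ ∈ O} with hE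
  by_contra hinf
  replace hinf : E.Infinite := hinf
  -- coordinates
  let Λ : K → ι ⊕ ι → ℝ := fun x => Sum.elim (fun i => k i * log (w i x))
    (fun i => k i * log (w i (1 - x)))
  let n : K → ℝ := fun x => ∑ j, |Λ x j|
  have hn : ∀ x, n x = sz w k x + sz w k (1 - x) := by
    intro x
    simp only [n, Λ, Fintype.sum_sum_type, Sum.elim_inl, Sum.elim_inr, sz]
  have hn0 : ∀ x, 0 ≤ n x := fun x => Finset.sum_nonneg fun j _ => abs_nonneg _
  have hsz0 : ∀ x, 0 ≤ sz w k x := fun x => Finset.sum_nonneg fun j _ => abs_nonneg _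
  have hle : ∀ x j, |Λ x j| ≤ n x := fun x j =>
    Finset.single_le_sum (f := fun j => |Λ x j|) (fun j _ => abs_nonneg _) (Finset.mem_univ j)
  -- pigeonhole on directions
  let m : ℕ := 64 * (Fintype.card (ι ⊕ ι) + 1)
  let fl : K → ι ⊕ ι → ℤ := fun x j => ⌊Λ x j / n x * m⌋
  have hm : (0 : ℝ) < m := by positivity
  have hfl : ∀ x, fl x ∈ Set.pi Set.univ (fun _ : ι ⊕ ι => Set.Icc (-(m : ℤ)) m) := by
    intro x j _
    have h1 : |Λ x j / n x| ≤ 1 := by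
      rw [abs_div, abs_of_nonneg (hn0 x)]
      exact div_le_one_of_le₀ (hle x j) (hn0 x)
    have h2 := abs_le.1 h1
    constructor
    · rw [Int.le_floor]; push_cast; nlinarith
    · have : (⌊Λ x j / n x * m⌋ : ℝ) ≤ m := (Int.floor_le _).trans (by nlinarith)
      exact_mod_cast this
  have hfin : (Set.pi Set.univ (fun _ : ι ⊕ ι => Set.Icc (-(m : ℤ)) m)).Finite :=
    Set.Finite.pi fun _ => Set.finite_Icc _ _
  obtain ⟨d, hd⟩ : ∃ d, (E ∩ fl ⁻¹' {d}).Infinite := by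
    by_contra hcon
    push Not at hcon
    apply hinf
    refine (hfin.biUnion (fun d _ => hcon d)).subset ?_
    intro x hx
    simp only [Set.mem_iUnion]
    exact ⟨fl x, hfl x, hx, rfl⟩
  have hbig : ∀ B : ℝ, ∃ x ∈ E ∩ fl ⁻¹' {d}, B < n x := by
    intro B
    by_contra hcon
    push Not at hcon
    apply hd
    refine (hnorth B).subset fun x hx => ⟨hx.1.1, hx.1.2.2.1, hx.1.2.2.2.1, ?_⟩
    have := hcon x hx
    rw [hn] at this
    linarith [hsz0 (1 - x)]
  set W := ∑ i, k i with hW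
  have hW0 : 0 ≤ W := Finset.sum_nonneg fun i _ => hk i
  obtain ⟨X, ⟨hXE, hXd⟩, hXn⟩ := hbig (1000 * W + 1)
  obtain ⟨x, ⟨hxE, hxd⟩, hxn⟩ := hbig (1000 * n X)
  have hnX : 0 < n X := by linarith
  have hnx : 0 < n x := by linarith
  set r := n x / n X with hr
  have hr1 : 1000 ≤ r := by rw [hr, le_div_iff₀ hnX]; linarith
  have hrn : r * n X = n x := by rw [hr]; field_simp
  set N := ⌊r / 2⌋₊ with hN
  have hN1 : (N : ℝ) ≤ r / 2 := Nat.floor_le (by linarith)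
  have hN2 : r / 2 < N + 1 := Nat.lt_floor_add_one _
  have hN3 : 1 ≤ N := by
    have : (1 : ℝ) ≤ N := by linarith
    exact_mod_cast this
  obtain ⟨e, he1, he2, hmain⟩ := main_ineq O w k hk hprod hXE.1 hXE.2.1 (by ring) hXE.2.2.1
    hXE.2.2.2.2.1 hXE.2.2.2.1 hXE.2.2.2.2.2 hxE.1 hxE.2.1 (by ring) hxE.2.2.1 hxE.2.2.2.2.1 N hN3
  have he1' : (2 * N : ℝ) ≤ e := by exact_mod_cast he1
  have he2' : (e : ℝ) ≤ 2 * N + 1 := by exact_mod_cast he2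
  -- lower bound for the left side
  have hS : n X / 4 ≤ ∑ i, k i * log (max 1 (max (w i X) (w i (1 - X)))) := by
    have a1 := sz_le O w k hk hprod hXE.1 hXE.2.2.1 hXE.2.2.2.1
      (fun i => max 1 (max (w i X) (w i (1 - X)))) (fun i => le_max_left _ _)
      (fun i => (le_max_left _ _).trans (le_max_right _ _))
    have a2 := sz_le O w k hk hprod hXE.2.1 hXE.2.2.2.2.1 hXE.2.2.2.2.2
      (fun i => max 1 (max (w i X) (w i (1 - X)))) (fun i => le_max_left _ _)
      (fun i => (le_max_right _ _).trans (le_max_right _ _))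
    rw [hn]
    linarith
  -- upper bound for the right side
  have hR : ∑ i, k i * (|log (w i x) - e * log (w i X)| + |log (w i (1 - x)) - e * log (w i (1 - X))|)
      = ∑ j, |Λ x j - e * Λ X j| := by
    simp only [Λ, Fintype.sum_sum_type, Sum.elim_inl, Sum.elim_inr]
    rw [← Finset.sum_add_distrib]
    refine Finset.sum_congr rfl fun i _ => ?_
    have : ∀ a b : ℝ, k i * |a - e * b| = |k i * a - e * (k i * b)| := by
      intro a b
      rw [← abs_of_nonneg (hk i), ← abs_mul, abs_of_nonneg (hk i)]
      congr 1; ring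
    rw [mul_add, this, this]
  have hdir : ∀ j, |Λ x j - r * Λ X j| ≤ n x / m := by
    intro j
    have h1 : fl x j = fl X j := by
      have : fl x = fl X := by rw [Set.mem_preimage.1 hxd, Set.mem_preimage.1 hXd]
      rw [this]
    have h2 := Int.abs_sub_lt_one_of_floor_eq_floor h1
    have h3 : Λ x j - r * Λ X j = (n x / m) * (Λ x j / n x * m - Λ X j / n X * m) := by
      rw [hr]; field_simp
    rw [h3, abs_mul, abs_of_nonneg (by positivity)]
    exact mul_le_of_le_one_right (by positivity) h2.le
  have hR2 : ∑ j, |Λ x j - e * Λ X j| ≤ n x / 64 + 4 * n X := by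
    have h1 : ∀ j, |Λ x j - e * Λ X j| ≤ n x / m + 4 * |Λ X j| := by
      intro j
      have h2 : Λ x j - e * Λ X j = (Λ x j - r * Λ X j) + (r - e) * Λ X j := by ring
      rw [h2]
      refine (abs_add_le _ _).trans (add_le_add (hdir j) ?_)
      rw [abs_mul]
      refine mul_le_mul_of_nonneg_right ?_ (abs_nonneg _)
      rw [abs_le]; constructor <;> linarith
    refine (Finset.sum_le_sum fun j _ => h1 j).trans ?_
    rw [Finset.sum_add_distrib, ← Finset.mul_sum, Finset.sum_const, Finset.card_univ, nsmul_eq_mul]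
    refine add_le_add ?_ le_rfl
    rw [← mul_div_assoc, div_le_div_iff₀ hm (by norm_num)]
    simp only [m]
    push_cast
    nlinarith
  rw [hR] at hmain
  have hlog2 : log 2 ≤ 1 := by
    have := log_two_lt_d9; linarith
  have hlog20 : 0 ≤ log 2 := log_nonneg (by norm_num)
  have hA : ((N : ℝ) - 1) * (n X / 4) ≤
      ((e : ℝ) - (N + 1)) * ∑ i, k i * log (max 1 (max (w i X) (w i (1 - X)))) := by
    apply mul_le_mul (by linarith) hS (by positivity)
    linarith
  have hB : W * ((3 * N + 4) * log 2) ≤ W * (3 * N + 4) := by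
    apply mul_le_mul_of_nonneg_left _ hW0
    nlinarith
  have hC : n x ≤ (2 * N + 2) * n X := by rw [← hrn]; nlinarith
  have hD : W * (3 * N + 4) ≤ (3 * N + 4) * (n X / 1000) := by nlinarith
  have hN500 : (499 : ℝ) ≤ N := by linarith
  nlinarith

end Dioph

end UnitEq

namespace UnitEq
section SUnit
open NumberField Real

variable {K : Type*} [Field K] [NumberField K]

/-- Elements integral outside a finite set of places. -/
def TInt (T : Finset (FinitePlace K)) : Subring K where
  carrier := {x | ∀ v : FinitePlace K, v ∉ T → v x ≤ 1}
  mul_mem' := by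
    intro a b ha hb v hv
    rw [map_mul]
    exact mul_le_one₀ (ha v hv) (apply_nonneg v b) (hb v hv)
  one_mem' := by
    intro v _
    rw [map_one]
  add_mem' := by
    intro a b ha hb v hv
    exact (FinitePlace.add_le v a b).trans (max_le (ha v hv) (hb v hv))
  zero_mem' := by
    intro v _
    rw [map_zero]; exact zero_le_one
  neg_mem' := by
    intro a ha v hv
    have : v (-a) = v a := v.1.map_neg a
    rw [this]; exact ha v hv

lemma mem_TInt {T : Finset (FinitePlace K)} {x : K} :
    x ∈ TInt T ↔ ∀ v : FinitePlace K, v ∉ T → v x ≤ 1 := Iff.rfl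

/-- the places used -/
def plc (T : Finset (FinitePlace K)) : InfinitePlace K ⊕ T → AbsoluteValue K ℝ :=
  Sum.elim (fun v => v.1) (fun v => v.1.1)

/-- the weights -/
noncomputable def wts (T : Finset (FinitePlace K)) : InfinitePlace K ⊕ T → ℝ :=
  Sum.elim (fun v => (v.mult : ℝ)) (fun _ => 1)

lemma TInt_prod (T : Finset (FinitePlace K)) (x : K) (hx : x ∈ TInt T) (hx0 : x ≠ 0) :
    0 ≤ ∑ i, wts T i * log (plc T i x) := by
  classical
  have h := prod_abs_eq_one hx0
  have hfin : (Function.mulSupport fun v : FinitePlace K => v x).Finite :=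
    FinitePlace.hasFiniteMulSupport hx0
  have hpos : ∀ v : FinitePlace K, 0 < v x := fun v => FinitePlace.pos_iff.2 hx0
  have hle : ∏ᶠ v : FinitePlace K, v x ≤ ∏ v ∈ T, v x := by
    rw [finprod_eq_prod_of_mulSupport_subset (s := hfin.toFinset ∪ T) (fun v : FinitePlace K => v x)
      (by intro v hv; rw [Finset.coe_union, Set.Finite.coe_toFinset]; left; exact hv)]
    rw [← Finset.prod_sdiff (Finset.subset_union_right : T ⊆ hfin.toFinset ∪ T)]
    refine mul_le_of_le_one_left (Finset.prod_nonneg fun v _ => (hpos v).le) ?_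
    refine Finset.prod_le_one (fun v _ => (hpos v).le) fun v hv => ?_
    exact hx v (Finset.mem_sdiff.1 hv).2
  have hipos : ∀ v : InfinitePlace K, 0 < v x := fun v => InfinitePlace.pos_iff.2 hx0
  have h1 : 1 ≤ (∏ w : InfinitePlace K, w x ^ w.mult) * ∏ v ∈ T, v x := by
    rw [← h]
    exact mul_le_mul_of_nonneg_left hle (Finset.prod_nonneg fun v _ => (pow_pos (hipos v) _).le)
  have h2 := log_nonneg h1
  rw [log_mul (Finset.prod_ne_zero_iff.2 fun v _ => (pow_pos (hipos v) _).ne')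
    (Finset.prod_ne_zero_iff.2 fun v _ => (hpos v).ne'),
    log_prod fun v _ => (pow_pos (hipos v) _).ne', log_prod fun v _ => (hpos v).ne'] at h2
  rw [Fintype.sum_sum_type]
  simp only [wts, plc, Sum.elim_inl, Sum.elim_inr, one_mul]
  rw [← Finset.sum_coe_sort T] at h2
  simp only [log_pow] at h2
  exact h2

lemma TInt_north (T : Finset (FinitePlace K)) (B : ℝ) :
    {x : K | x ≠ 0 ∧ x ∈ TInt T ∧ x⁻¹ ∈ TInt T ∧ sz (plc T) (wts T) x ≤ B}.Finite := by
  classical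
  refine (NumberField.finite_setOfPred_logHeight₁_le K B).subset ?_
  rintro x ⟨hx0, hx, _, hB⟩
  refine le_trans ?_ hB
  rw [NumberField.logHeight₁_eq, finsum_eq_sum_of_support_subset (s := T)]
  · simp only [sz]
    rw [Fintype.sum_sum_type, ← Finset.sum_coe_sort T]
    simp only [wts, plc, Sum.elim_inl, Sum.elim_inr, one_mul]
    have hl : ∀ t : ℝ, log⁺ t ≤ |log t| := fun t => max_le (abs_nonneg _) (le_abs_self _)
    refine add_le_add (Finset.sum_le_sum fun v _ => ?_) (Finset.sum_le_sum fun v _ => hl _)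
    rw [abs_mul, abs_of_nonneg (Nat.cast_nonneg _)]
    exact mul_le_mul_of_nonneg_left (hl _) (Nat.cast_nonneg _)
  · intro v hv
    by_contra hvT
    apply hv
    exact posLog_eq_zero_iff _ |>.2 (by rw [abs_of_nonneg (apply_nonneg v x)]; exact hx v hvT)

/-- Being a unit outside `T`. -/
def IsTU (T : Finset (FinitePlace K)) (x : K) : Prop := ∀ v : FinitePlace K, v ∉ T → v x = 1

lemma IsTU.mem {T : Finset (FinitePlace K)} {x : K} (h : IsTU T x) : x ∈ TInt T :=
  fun v hv => (h v hv).le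

lemma IsTU.mul {T : Finset (FinitePlace K)} {x y : K} (h : IsTU T x) (h' : IsTU T y) :
    IsTU T (x * y) := fun v hv => by rw [map_mul, h v hv, h' v hv, one_mul]

lemma IsTU.inv {T : Finset (FinitePlace K)} {x : K} (h : IsTU T x) :
    IsTU T x⁻¹ := fun v hv => by rw [map_inv₀, h v hv, inv_one]

lemma IsTU.div {T : Finset (FinitePlace K)} {x y : K} (h : IsTU T x) (h' : IsTU T y) :
    IsTU T (x / y) := by rw [div_eq_mul_inv]; exact h.mul h'.inv

lemma IsTU.pow {T : Finset (FinitePlace K)} {x : K} (h : IsTU T x) (n : ℕ) :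
    IsTU T (x ^ n) := fun v hv => by rw [map_pow, h v hv, one_pow]

lemma place_neg (v : FinitePlace K) (x : K) : v (-x) = v x := v.1.map_neg x

lemma IsTU.neg {T : Finset (FinitePlace K)} {x : K} (h : IsTU T x) :
    IsTU T (-x) := fun v hv => by rw [place_neg, h v hv]

theorem sunit_finite (T : Finset (FinitePlace K)) :
    {x : K | x ≠ 0 ∧ 1 - x ≠ 0 ∧ IsTU T x ∧ IsTU T (1 - x)}.Finite := by
  refine (unit_eq_finite (TInt T) (plc T) (wts T) ?_ (TInt_prod T) (TInt_north T)).subset ?_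
  · rintro (v | v)
    · exact Nat.cast_nonneg _
    · exact zero_le_one
  · rintro x ⟨h0, h1, h2, h3⟩
    exact ⟨h0, h1, h2.mem, h2.inv.mem, h3.mem, h3.inv.mem⟩

/-- finitely many `l` with `l - a` and `l - b` both `T`-units -/
theorem sunit_shift (T : Finset (FinitePlace K)) (a b : K) (hab : a ≠ b) (hu : IsTU T (b - a)) :
    {l : K | l ≠ a ∧ l ≠ b ∧ IsTU T (l - a) ∧ IsTU T (l - b)}.Finite := by
  have hba : b - a ≠ 0 := sub_ne_zero.2 hab.symm
  refine ((sunit_finite T).image fun x => a + (b - a) * x).subset ?_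
  rintro l ⟨h1, h2, h3, h4⟩
  have e : 1 - (l - a) / (b - a) = - ((l - b) / (b - a)) := by field_simp; ring
  refine ⟨(l - a) / (b - a), ⟨div_ne_zero (sub_ne_zero.2 h1) hba, ?_, h3.div hu, ?_⟩, ?_⟩
  · rw [e]; exact neg_ne_zero.2 (div_ne_zero (sub_ne_zero.2 h2) hba)
  · rw [e]; exact (h4.div hu).neg
  · simp only; field_simp; ring

/-- a finite set of nonzero elements consists of `T`-units for some finite `T` -/
lemma exists_T (s : Set K) (hs : s.Finite) :
    ∃ T : Finset (FinitePlace K), ∀ x ∈ s, x ≠ 0 → IsTU T x := by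
  classical
  have : (⋃ x ∈ s, {v : FinitePlace K | x ≠ 0 ∧ v x ≠ 1}).Finite := by
    refine hs.biUnion fun x _ => ?_
    by_cases hx : x = 0
    · simp [hx]
    · exact (FinitePlace.hasFiniteMulSupport hx).subset fun v hv => hv.2
  refine ⟨this.toFinset, fun x hx hx0 v hv => ?_⟩
  by_contra h
  apply hv
  simp only [Set.Finite.mem_toFinset, Set.mem_iUnion]
  exact ⟨x, hx, hx0, h⟩

end SUnit
end UnitEq

namespace UnitEq
section Curve
open NumberField Polynomial

variable {K : Type*} [Field K] [NumberField K]

lemma isTU_of_mul {T : Finset (FinitePlace K)} {x y : K} (hx : x ∈ TInt T) (hy : y ∈ TInt T)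
    (h : IsTU T (x * y)) : IsTU T x := by
  intro v hv
  have h1 := h v hv
  rw [map_mul] at h1
  have h2 := hx v hv
  have h3 := hy v hv
  refine le_antisymm h2 ?_
  rw [← h1]
  exact mul_le_of_le_one_right (apply_nonneg v x) h3

lemma eval_mem {T : Finset (FinitePlace K)} {q : K[X]} {l : K}
    (hq : ∀ i, q.coeff i ∈ TInt T) (hl : l ∈ TInt T) : q.eval l ∈ TInt T := by
  rw [eval_eq_sum_range]
  exact Subring.sum_mem _ fun i _ => Subring.mul_mem _ (hq i) (Subring.pow_mem _ hl i)

lemma exists_T' (s : Set K) (hs : s.Finite) (P : Set K[X]) (hP : P.Finite) :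
    ∃ T : Finset (FinitePlace K), (∀ x ∈ s, x ≠ 0 → IsTU T x) ∧ (∀ x ∈ s, x ∈ TInt T) ∧
      ∀ q ∈ P, (∀ i, q.coeff i ∈ TInt T) ∧ (q ≠ 0 → IsTU T q.leadingCoeff) := by
  obtain ⟨T, hT⟩ := exists_T (s ∪ ⋃ q ∈ P, (q.coeffs : Set K))
    (hs.union (hP.biUnion fun q _ => Finset.finite_toSet _))
  refine ⟨T, fun x hx => hT x (Or.inl hx), fun x hx => ?_, fun q hq => ⟨fun i => ?_, fun h => ?_⟩⟩
  · by_cases h : x = 0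
    · rw [h]; exact Subring.zero_mem _
    · exact (hT x (Or.inl hx) h).mem
  · by_cases h : q.coeff i = 0
    · rw [h]; exact Subring.zero_mem _
    · refine (hT _ (Or.inr ?_) h).mem
      simp only [Set.mem_iUnion]
      exact ⟨q, hq, coeff_mem_coeffs h⟩
  · have h' : q.leadingCoeff ≠ 0 := leadingCoeff_ne_zero.2 h
    refine hT _ (Or.inr ?_) h'
    simp only [Set.mem_iUnion]
    exact ⟨q, hq, coeff_mem_coeffs h'⟩

/-- integrality of solutions in degree at least two -/
lemma sol_mem {T : Finset (FinitePlace K)} {c : K[X]} (hd : 2 ≤ c.natDegree)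
    (hc : ∀ i, c.coeff i ∈ TInt T) (hlc : IsTU T c.leadingCoeff) {a x l : K} (ha : a ∈ TInt T)
    (hx : x ∈ TInt T) (h : (l - a) * x = c.eval l) : l ∈ TInt T := by
  intro v hv
  by_contra hcon
  push Not at hcon
  obtain ⟨d, hd'⟩ : ∃ d, c.natDegree = d + 1 := ⟨c.natDegree - 1, by omega⟩
  have hd1 : 1 ≤ d := by omega
  rw [eval_eq_sum_range, Finset.sum_range_succ] at h
  have hlc' : v (c.coeff c.natDegree) = 1 := hlc v hv
  have hl0 : (0 : ℝ) ≤ v l := apply_nonneg v l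
  have hpow : 1 ≤ (v l) ^ d := one_le_pow₀ hcon.le
  have hl1 : v l ≤ (v l) ^ d := le_self_pow₀ hcon.le (by omega)
  have hsub : ∀ p q : K, v (p - q) ≤ max (v p) (v q) := by
    intro p q
    rw [sub_eq_add_neg]
    refine (FinitePlace.add_le v p (-q)).trans ?_
    rw [place_neg]
  have e : c.coeff c.natDegree * l ^ c.natDegree = (l - a) * x -
      ∑ i ∈ Finset.range c.natDegree, c.coeff i * l ^ i := by rw [h]; ring
  have h1 : v ((l - a) * x) ≤ (v l) ^ d := by
    rw [map_mul]
    refine (mul_le_of_le_one_right (apply_nonneg v _) (hx v hv)).trans ?_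
    exact (hsub l a).trans (max_le hl1 ((ha v hv).trans hpow))
  have h2 : v (∑ i ∈ Finset.range c.natDegree, c.coeff i * l ^ i) ≤ (v l) ^ d := by
    refine Finset.sum_induction _ (fun t => v t ≤ (v l) ^ d) ?_ ?_ ?_
    · intro p q hp hq
      exact (FinitePlace.add_le v p q).trans (max_le hp hq)
    · rw [map_zero]; positivity
    · intro i hi
      rw [Finset.mem_range] at hi
      rw [map_mul, map_pow]
      refine (mul_le_of_le_one_left (by positivity) (hc i v hv)).trans ?_
      exact pow_le_pow_right₀ hcon.le (by omega)
  have h3 : (v l) ^ (d + 1) ≤ (v l) ^ d := by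
    have : v (c.coeff c.natDegree * l ^ c.natDegree) = (v l) ^ (d + 1) := by
      rw [map_mul, hlc', one_mul, map_pow, hd']
    rw [← this, e]
    exact (hsub _ _).trans (max_le h1 h2)
  rw [pow_succ] at h3
  nlinarith

lemma caseAB (α : K) (hα : α ≠ 0) (c : K[X]) (hd : 2 ≤ c.natDegree) (hs : c.Splits) (a : K)
    (hca : c.eval a ≠ 0) : {l : K | ∃ m : ℕ, (l - a) * α ^ m = c.eval l}.Finite := by
  obtain ⟨r, hr⟩ := hs.exists_eval_eq_zero (by rw [degree_eq_natDegree (by rintro rfl; simp at hd)]; exact_mod_cast (by omega))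
  have hra : r ≠ a := by rintro rfl; exact hca hr
  have hc0 : c ≠ 0 := by rintro rfl; simp at hd
  obtain ⟨q, hq⟩ := dvd_iff_isRoot.2 hr
  obtain ⟨e, he⟩ : X - C a ∣ c - C (c.eval a) := dvd_iff_isRoot.2 (by simp)
  obtain ⟨T, hT1, hT2, hT3⟩ := exists_T' {α, a, r, a - r, r - a, c.eval a} (Set.toFinite _) {c, q, e}
    (Set.toFinite _)
  refine (sunit_shift T a r hra.symm (hT1 _ (by simp) (sub_ne_zero.2 hra))).subset ?_
  rintro l ⟨m, hl⟩
  have hαu : IsTU T (α ^ m) := (hT1 α (by simp) hα).pow m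
  have ha : a ∈ TInt T := hT2 a (by simp)
  have hr' : r ∈ TInt T := hT2 r (by simp)
  have hlO : l ∈ TInt T := sol_mem hd (hT3 c (by simp)).1 ((hT3 c (by simp)).2 hc0) ha hαu.mem hl
  have e1 : (l - a) * (α ^ m - e.eval l) = c.eval a := by
    have := congrArg (eval l) he
    simp only [eval_sub, eval_C, eval_mul, eval_X] at this
    rw [mul_sub, hl, ← this]; ring
  have u1 : IsTU T (l - a) := by
    refine isTU_of_mul (Subring.sub_mem _ hlO ha)
      (Subring.sub_mem _ hαu.mem (eval_mem (hT3 e (by simp)).1 hlO)) ?_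
    rw [e1]; exact hT1 _ (by simp) hca
  have hla : l ≠ a := by rintro rfl; apply hca; rw [← e1]; ring
  have e2 : (l - r) * q.eval l = (l - a) * α ^ m := by
    rw [hl]
    conv_rhs => rw [hq]
    simp
  have u2 : IsTU T (l - r) := by
    refine isTU_of_mul (Subring.sub_mem _ hlO hr') (eval_mem (hT3 q (by simp)).1 hlO) ?_
    rw [e2]; exact u1.mul hαu
  refine ⟨hla, ?_, u1, u2⟩
  rintro rfl
  rw [sub_self, zero_mul] at e2
  exact mul_ne_zero (sub_ne_zero.2 hla) (pow_ne_zero m hα) e2.symm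

lemma factor_root {K : Type*} [Field K] (c : K[X]) (hd : 2 ≤ c.natDegree) (hs : c.Splits) (a : K) (hca : c.eval a = 0) :
    ∃ r q, c = (X - C a) * ((X - C r) * q) := by
  have hc0 : c ≠ 0 := by rintro rfl; simp at hd
  obtain ⟨e, he⟩ : X - C a ∣ c := dvd_iff_isRoot.2 hca
  have he0 : e ≠ 0 := by rintro rfl; rw [mul_zero] at he; exact hc0 he
  have hdeg : c.natDegree = 1 + e.natDegree := by
    rw [he, natDegree_mul (X_sub_C_ne_zero a) he0, natDegree_X_sub_C]
  have hes : e.Splits := hs.of_dvd hc0 ⟨X - C a, by rw [he]; ring⟩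
  obtain ⟨r, hr⟩ := hes.exists_eval_eq_zero (by rw [degree_eq_natDegree he0]; exact_mod_cast (by omega))
  obtain ⟨q, hq⟩ := dvd_iff_isRoot.2 hr
  exact ⟨r, q, by rw [← hq]; exact he⟩

lemma caseC (α δ : K) (hα : α ≠ 0) (hδ : δ ≠ 0) (c : K[X]) (hd : 2 ≤ c.natDegree) (hs : c.Splits)
    (hs1 : (c - 1).Splits) (h0 : c.eval 0 = 0) (h1 : c.eval 1 = 1) :
    {l : K | l ≠ 0 ∧ l ≠ 1 ∧ ∃ m n : ℕ, l * α ^ m = c.eval l ∧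
      (l - 1) * δ ^ n = c.eval l - 1}.Finite := by
  have hc0 : c ≠ 0 := by rintro rfl; simp at hd
  obtain ⟨r, q, hq⟩ := factor_root c hd hs 0 h0
  have hd1 : (c - 1).natDegree = c.natDegree := by rw [← C_1]; exact natDegree_sub_C
  obtain ⟨s, p, hp⟩ := factor_root (c - 1) (hd1 ▸ hd) hs1 1 (by simp [h1])
  have hrs : r ≠ s := by
    rintro rfl
    have a1 := congrArg (eval r) hq
    have a2 := congrArg (eval r) hp
    simp [a1] at a1 a2
  obtain ⟨T, hT1, hT2, hT3⟩ := exists_T' {α, δ, r, s, s - r} (Set.toFinite _) {c, q, p}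
    (Set.toFinite _)
  refine (sunit_shift T r s hrs (hT1 _ (by simp) (sub_ne_zero.2 hrs.symm))).subset ?_
  rintro l ⟨hl0, hl1, m, n, e1, e2⟩
  have hαu : IsTU T (α ^ m) := (hT1 α (by simp) hα).pow m
  have hδu : IsTU T (δ ^ n) := (hT1 δ (by simp) hδ).pow n
  have hlO : l ∈ TInt T := sol_mem hd (hT3 c (by simp)).1 ((hT3 c (by simp)).2 hc0)
    (Subring.zero_mem _) hαu.mem (by rw [sub_zero]; exact e1)
  have f1 : (l - r) * q.eval l = α ^ m := by
    have a1 := congrArg (eval l) hq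
    simp only [eval_mul, eval_sub, eval_X, eval_C, sub_zero] at a1
    rw [← e1] at a1
    exact (mul_left_cancel₀ hl0 a1).symm
  have f2 : (l - s) * p.eval l = δ ^ n := by
    have a1 := congrArg (eval l) hp
    simp only [eval_mul, eval_sub, eval_X, eval_C, eval_one] at a1
    rw [← e2] at a1
    exact (mul_left_cancel₀ (sub_ne_zero.2 hl1) a1).symm
  refine ⟨?_, ?_, ?_, ?_⟩
  · rintro rfl; rw [sub_self, zero_mul] at f1; exact pow_ne_zero m hα f1.symm
  · rintro rfl; rw [sub_self, zero_mul] at f2; exact pow_ne_zero n hδ f2.symm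
  · exact isTU_of_mul (Subring.sub_mem _ hlO (hT2 r (by simp))) (eval_mem (hT3 q (by simp)).1 hlO)
      (by rw [f1]; exact hαu)
  · exact isTU_of_mul (Subring.sub_mem _ hlO (hT2 s (by simp))) (eval_mem (hT3 p (by simp)).1 hlO)
      (by rw [f2]; exact hδu)

lemma case0 (α δ k : K) (hα : α ≠ 0) (hδ : δ ≠ 0) (hk0 : k ≠ 0) (hk1 : k ≠ 1) :
    {l : K | l ≠ 0 ∧ l ≠ 1 ∧ ∃ m n : ℕ, l * α ^ m = k ∧ (l - 1) * δ ^ n = k - 1}.Finite := by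
  obtain ⟨T, hT⟩ := exists_T {α, δ, k, k - 1, (1 : K) - 0} (Set.toFinite _)
  refine (sunit_shift T 0 1 zero_ne_one (hT _ (by simp) (by simp))).subset ?_
  rintro l ⟨hl0, hl1, m, n, e1, e2⟩
  have hαu : IsTU T (α ^ m) := (hT α (by simp) hα).pow m
  have hδu : IsTU T (δ ^ n) := (hT δ (by simp) hδ).pow n
  refine ⟨hl0, hl1, ?_, ?_⟩
  · rw [sub_zero, eq_div_of_mul_eq (pow_ne_zero m hα) e1]
    exact (hT k (by simp) hk0).div hαu
  · rw [eq_div_of_mul_eq (pow_ne_zero n hδ) e2]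
    exact (hT _ (by simp) (sub_ne_zero.2 hk1)).div hδu

lemma case1 (α δ a b : K) (hα : α ≠ 0) (hδ : δ ≠ 0) (ha : a ≠ 0) (hb : b ≠ 0) (hab : a + b ≠ 1)
    (hn : ¬ (b = 1 ∧ a = -1)) :
    {l : K | l ≠ 0 ∧ l ≠ 1 ∧ ∃ m n : ℕ, l * α ^ m = a * l + b ∧
      (l - 1) * δ ^ n = a * l + b - 1}.Finite := by
  have hab' : a + b - 1 ≠ 0 := sub_ne_zero.2 hab
  obtain ⟨T, hT1, hT2, -⟩ := exists_T' {α, δ, a, b, a + b - 1, -a / b - 1, a - -1} (Set.toFinite _) ∅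
    (Set.toFinite _)
  have key : ∀ l : K, l ≠ 0 → l ≠ 1 → ∀ m n : ℕ, l * α ^ m = a * l + b →
      (l - 1) * δ ^ n = a * l + b - 1 →
      (b * (l⁻¹ - -a / b) = α ^ m ∧ (a + b - 1) * (l - 1)⁻¹ + a = δ ^ n ∧
        IsTU T (α ^ m) ∧ IsTU T (δ ^ n) ∧ IsTU T (l⁻¹ - 1) ∧ IsTU T ((l - 1)⁻¹ - -1)) := by
    intro l hl0 hl1 m n e1 e2
    have hl1' : l - 1 ≠ 0 := sub_ne_zero.2 hl1
    have hαu : IsTU T (α ^ m) := (hT1 α (by simp) hα).pow m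
    have hδu : IsTU T (δ ^ n) := (hT1 δ (by simp) hδ).pow n
    have f1 : l⁻¹ = (α ^ m - a) * b⁻¹ := by
      field_simp
      linear_combination -e1
    have f2 : (l - 1)⁻¹ = (δ ^ n - a) * (a + b - 1)⁻¹ := by
      field_simp
      linear_combination -e2
    have aO := hT2 a (by simp)
    have i1 : l⁻¹ ∈ TInt T := by
      rw [f1]
      exact Subring.mul_mem _ (Subring.sub_mem _ hαu.mem aO) (hT1 b (by simp) hb).inv.mem
    have i2 : (l - 1)⁻¹ ∈ TInt T := by
      rw [f2]
      exact Subring.mul_mem _ (Subring.sub_mem _ hδu.mem aO) (hT1 _ (by simp) hab').inv.mem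
    have g : (l⁻¹ - 1) * ((l - 1)⁻¹ - -1) = -1 := by field_simp; ring
    have one : IsTU T (-1 : K) := fun v _ => by rw [place_neg, map_one]
    have j1 : l⁻¹ - 1 ∈ TInt T := Subring.sub_mem _ i1 (Subring.one_mem _)
    have j2 : (l - 1)⁻¹ - -1 ∈ TInt T := Subring.sub_mem _ i2 one.mem
    refine ⟨?_, ?_, hαu, hδu, isTU_of_mul j1 j2 (by rw [g]; exact one),
      isTU_of_mul j2 j1 (by rw [mul_comm, g]; exact one)⟩
    · rw [f1]; field_simp; ring
    · rw [f2]; field_simp; ring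
  by_cases hs : a + b = 0
  · have ha1 : a ≠ -1 := by
      rintro rfl; exact hn ⟨by linear_combination hs, rfl⟩
    refine ((sunit_shift T (-1) a ha1.symm (hT1 _ (by simp) (sub_ne_zero.2 ha1))).image
      fun t => 1 + t⁻¹).subset ?_
    rintro l ⟨hl0, hl1, m, n, e1, e2⟩
    obtain ⟨k1, k2, k3, k4, k5, k6⟩ := key l hl0 hl1 m n e1 e2
    have hl1' : l - 1 ≠ 0 := sub_ne_zero.2 hl1
    have e3 : (l - 1)⁻¹ - a = - δ ^ n := by
      rw [← k2, hs]; ring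
    refine ⟨(l - 1)⁻¹, ⟨?_, ?_, k6, by rw [e3]; exact k4.neg⟩, by simp⟩
    · intro h; field_simp at h; apply hl0; linear_combination h
    · intro h; rw [h, sub_self] at e3; exact neg_ne_zero.2 (pow_ne_zero n hδ) e3.symm
  · have h1 : -a / b ≠ 1 := by
      intro h; field_simp at h; apply hs; linear_combination -h
    refine ((sunit_shift T 1 (-a / b) h1.symm (hT1 _ (by simp) (sub_ne_zero.2 h1))).image
      fun t => t⁻¹).subset ?_
    rintro l ⟨hl0, hl1, m, n, e1, e2⟩
    obtain ⟨k1, k2, k3, k4, k5, k6⟩ := key l hl0 hl1 m n e1 e2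
    have e3 : l⁻¹ - -a / b = α ^ m / b := by rw [← k1]; field_simp
    refine ⟨l⁻¹, ⟨?_, ?_, k5, by rw [e3]; exact k3.div (hT1 b (by simp) hb)⟩, by simp⟩
    · intro h; exact hl1 (inv_eq_one.1 h)
    · intro h; rw [h, sub_self] at e3; exact div_ne_zero (pow_ne_zero m hα) hb e3.symm

theorem curve_splits (α δ : K) (hα : α ≠ 0) (hδ : δ ≠ 0) (c : K[X]) (hs : c.Splits)
    (hs1 : (c - 1).Splits) (h1 : ¬ (c.natDegree ≤ 1 ∧ c.coeff 0 = 0))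
    (h2 : ¬ (c.natDegree ≤ 1 ∧ c.coeff 1 + c.coeff 0 = 1))
    (h3 : ¬ (c.natDegree ≤ 1 ∧ c.coeff 0 = 1 ∧ c.coeff 1 = -1)) :
    {l : K | l ≠ 0 ∧ l ≠ 1 ∧ ∃ m n : ℕ, l * α ^ m = c.eval l ∧
      (l - 1) * δ ^ n = c.eval l - 1}.Finite := by
  rcases lt_or_ge 1 c.natDegree with hd | hd
  · by_cases h0 : c.eval 0 = 0
    · by_cases h1 : c.eval 1 = 1
      · exact caseC α δ hα hδ c hd hs hs1 h0 h1
      · have hd1 : (c - 1).natDegree = c.natDegree := by rw [← C_1]; exact natDegree_sub_C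
        refine (caseAB δ hδ (c - 1) (hd1 ▸ hd) hs1 1 (by simpa [sub_eq_zero] using h1)).subset ?_
        rintro l ⟨-, -, m, n, e1, e2⟩
        exact ⟨n, by rw [e2]; simp⟩
    · refine (caseAB α hα c hd hs 0 h0).subset ?_
      rintro l ⟨-, -, m, n, e1, e2⟩
      exact ⟨m, by rw [← e1]; ring⟩
  · have hc : ∀ l, c.eval l = c.coeff 1 * l + c.coeff 0 := by
      intro l
      conv_lhs => rw [eq_X_add_C_of_natDegree_le_one hd]
      simp
    simp only [hc]
    by_cases ha : c.coeff 1 = 0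
    · simp only [ha, zero_mul, zero_add]
      exact case0 α δ _ hα hδ (fun h => h1 ⟨hd, h⟩) (fun h => h2 ⟨hd, by rw [ha, h, zero_add]⟩)
    · exact case1 α δ _ _ hα hδ ha (fun h => h1 ⟨hd, h⟩) (fun h => h2 ⟨hd, h⟩)
        (fun h => h3 ⟨hd, h⟩)

theorem curve_finite (α δ : K) (hα : α ≠ 0) (hδ : δ ≠ 0) (c : K[X])
    (h1 : ¬ (c.natDegree ≤ 1 ∧ c.coeff 0 = 0))
    (h2 : ¬ (c.natDegree ≤ 1 ∧ c.coeff 1 + c.coeff 0 = 1))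
    (h3 : ¬ (c.natDegree ≤ 1 ∧ c.coeff 0 = 1 ∧ c.coeff 1 = -1)) :
    {l : K | l ≠ 0 ∧ l ≠ 1 ∧ ∃ m n : ℕ, l * α ^ m = c.eval l ∧
      (l - 1) * δ ^ n = c.eval l - 1}.Finite := by
  have hc0 : c ≠ 0 := by rintro rfl; simp at h1
  have hc1 : c - 1 ≠ 0 := by
    intro h
    rw [sub_eq_zero] at h
    apply h2
    rw [h]
    simp [coeff_one]
  let L := (c * (c - 1)).SplittingField
  have : NumberField L := NumberField.of_module_finite K L
  let φ := algebraMap K L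
  have hsp : ((c * (c - 1)).map φ).Splits := SplittingField.splits _
  have hne : (c * (c - 1)).map φ ≠ 0 := map_ne_zero (mul_ne_zero hc0 hc1)
  have hs : (c.map φ).Splits := hsp.of_dvd hne ⟨(c - 1).map φ, by rw [Polynomial.map_mul]⟩
  have hs1 : (c.map φ - 1).Splits := by
    refine hsp.of_dvd hne ⟨c.map φ, ?_⟩
    rw [Polynomial.map_mul, Polynomial.map_sub, Polynomial.map_one]
    ring
  have hinj : Function.Injective φ := φ.injective
  have := curve_splits (φ α) (φ δ) ((_root_.map_ne_zero φ).2 hα) ((_root_.map_ne_zero φ).2 hδ) (c.map φ) hs hs1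
    (by
      simp only [natDegree_map, coeff_map, _root_.map_eq_zero]; exact h1)
    (by
      simp only [natDegree_map, coeff_map]
      rintro ⟨a, b⟩
      exact h2 ⟨a, hinj (by rw [map_add, b, map_one])⟩)
    (by
      simp only [natDegree_map, coeff_map]
      rintro ⟨a, b, d⟩
      exact h3 ⟨a, hinj (by rw [b, map_one]), hinj (by rw [d, map_neg, map_one])⟩)
  refine (this.preimage (f := φ) hinj.injOn).subset ?_
  rintro l ⟨a, b, m, n, e1, e2⟩
  refine ⟨(_root_.map_ne_zero φ).2 a, fun h => b (hinj (by rw [h, map_one])), m, n, ?_, ?_⟩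
  · rw [eval_map_apply, ← e1, map_mul, map_pow]
  · rw [eval_map_apply, ← map_one φ, ← map_sub, ← map_sub, ← e2, map_mul, map_pow]

end Curve
end UnitEq

namespace UnitEq
section Spec
open NumberField Polynomial

lemma torsion_bound {K : Type*} [Field K] [NumberField K] (D : ℕ)
    (hD : Module.finrank ℚ K ≤ D) (x : K) (k : ℕ) (hk : 1 ≤ k) (hx : x ^ k = 1) :
    x ^ (2 * D).factorial = 1 := by
  have hfo : IsOfFinOrder x := isOfFinOrder_iff_pow_eq_one.2 ⟨k, hk, hx⟩
  have hn : 0 < orderOf x := hfo.orderOf_pos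
  have hp : IsPrimitiveRoot x (orderOf x) := IsPrimitiveRoot.orderOf x
  have h1 : (orderOf x).totient ≤ D := by
    refine le_trans ?_ hD
    rw [← natDegree_cyclotomic (orderOf x) ℚ, cyclotomic_eq_minpoly_rat hp hn]
    exact minpoly.natDegree_le x
  apply orderOf_dvd_iff_pow_eq_one.1
  rw [Nat.dvd_iff_prime_pow_dvd_dvd]
  intro p e hpp hpe
  rcases Nat.eq_zero_or_pos e with rfl | he
  · simp
  · apply Nat.dvd_factorial (Nat.pow_pos hpp.pos)
    have h2 := Nat.le_of_dvd (Nat.totient_pos.2 hn) (Nat.totient_dvd_of_dvd hpe)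
    rw [Nat.totient_prime_pow hpp he] at h2
    obtain ⟨e', rfl⟩ : ∃ e', e = e' + 1 := ⟨e - 1, by omega⟩
    have h3 := hpp.two_le
    have h4 : p ≤ 2 * (p - 1) := by omega
    calc p ^ (e' + 1) = p ^ e' * p := pow_succ _ _
      _ ≤ p ^ e' * (2 * (p - 1)) := Nat.mul_le_mul_left _ h4
      _ = 2 * (p ^ (e' + 1 - 1) * (p - 1)) := by simp; ring
      _ ≤ 2 * D := by omega

lemma spec_finite {A R K : Type} [CommRing A] [CommRing R] [Algebra A R] [Field K] [CharZero K]
    (φ : R →+* K) (hφ : Function.Surjective φ) (G : Finset R)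
    (hG : Submodule.span A (G : Set R) = ⊤) (ev : A → ℚ)
    (hmk : ∀ a : A, φ (algebraMap A R a) = algebraMap ℚ K (ev a)) :
    FiniteDimensional ℚ K ∧ Module.finrank ℚ K ≤ G.card := by
  classical
  have hspan : Submodule.span ℚ ((G.image φ : Finset K) : Set K) = ⊤ := by
    rw [eq_top_iff]
    rintro z -
    obtain ⟨r, rfl⟩ := hφ z
    have hr : r ∈ Submodule.span A (G : Set R) := by rw [hG]; trivial
    induction hr using Submodule.span_induction with
    | mem x hx => exact Submodule.subset_span (by simpa using ⟨x, hx, rfl⟩)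
    | zero => rw [map_zero]; exact Submodule.zero_mem _
    | add x y _ _ hx hy => rw [map_add]; exact Submodule.add_mem _ hx hy
    | smul b x _ hx =>
      rw [Algebra.smul_def, map_mul, hmk, ← Algebra.smul_def]
      exact Submodule.smul_mem _ _ hx
  refine ⟨⟨⟨_, hspan⟩⟩, ?_⟩
  rw [← finrank_top ℚ K, ← hspan]
  exact (finrank_span_finset_le_card _).trans Finset.card_image_le

lemma exists_spec (R : Type) [CommRing R] [IsDomain R] [Algebra ℚ R] [Algebra.FiniteType ℚ R] :
    ∃ D : ℕ, ∀ h : R, h ≠ 0 → ∃ (K : Type) (_ : Field K) (_ : NumberField K) (φ : R →+* K),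
      Module.finrank ℚ K ≤ D ∧ φ h ≠ 0 := by
  obtain ⟨s, g, hinj, hfin⟩ := exists_finite_inj_algHom_of_fg ℚ R
  let A := MvPolynomial (Fin s) ℚ
  let : Algebra A R := g.toRingHom.toAlgebra
  have hAR : ∀ a : A, algebraMap A R a = g a := fun a => rfl
  have : Module.Finite A R := hfin
  have : IsScalarTower ℚ A R := IsScalarTower.of_algebraMap_eq fun q => (g.commutes q).symm
  obtain ⟨G, hG⟩ := Module.Finite.fg_top (R := A) (M := R)
  refine ⟨G.card, fun h hh => ?_⟩
  have hint : Algebra.IsIntegral A R := inferInstance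
  have hne : (Ideal.span {h}).comap (algebraMap A R) ≠ ⊥ :=
    Ideal.comap_ne_bot_of_integral_mem hh (Ideal.mem_span_singleton_self h) (hint.isIntegral h)
  obtain ⟨a, ha, ha0⟩ := Submodule.exists_mem_ne_zero_of_ne_bot hne
  obtain ⟨t, ht⟩ : ∃ t : Fin s → ℚ, MvPolynomial.eval t a ≠ 0 := by
    by_contra hcon
    push Not at hcon
    exact ha0 (MvPolynomial.funext fun t => by rw [hcon t, map_zero])
  let P : Ideal A := RingHom.ker (MvPolynomial.eval t)
  have hPm : P.IsMaximal := RingHom.ker_isMaximal_of_surjective _ 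
    fun q => ⟨MvPolynomial.C q, MvPolynomial.eval_C q⟩
  obtain ⟨Q, hQ, hQP⟩ := Ideal.exists_ideal_over_prime_of_isIntegral_of_isDomain (S := R) P (by
    rw [(RingHom.injective_iff_ker_eq_bot _).1 (show Function.Injective (algebraMap A R) from hinj)]
    exact bot_le)
  have hQm : Q.IsMaximal := Ideal.isMaximal_of_isIntegral_of_isMaximal_comap (R := A) Q (by rw [hQP]; exact hPm)
  let : Field (R ⧸ Q) := Ideal.Quotient.field Q
  have : CharZero (R ⧸ Q) := algebraRat.charZero _
  have hmk : ∀ a : A, Ideal.Quotient.mk Q (algebraMap A R a) =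
      algebraMap ℚ (R ⧸ Q) (MvPolynomial.eval t a) := by
    intro a
    have h1 : a - algebraMap ℚ A (MvPolynomial.eval t a) ∈ Q.comap (algebraMap A R) := by
      rw [hQP]
      change MvPolynomial.eval t (a - MvPolynomial.C (MvPolynomial.eval t a)) = 0
      rw [map_sub, MvPolynomial.eval_C, sub_self]
    rw [Ideal.mem_comap, map_sub, ← Ideal.Quotient.mk_eq_mk_iff_sub_mem] at h1
    rw [h1, ← IsScalarTower.algebraMap_apply ℚ A R]
    exact RingHom.congr_fun (Subsingleton.elim ((Ideal.Quotient.mk Q).comp (algebraMap ℚ R))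
      (algebraMap ℚ (R ⧸ Q))) _
  obtain ⟨hf1, hf2⟩ := spec_finite (Ideal.Quotient.mk Q) Ideal.Quotient.mk_surjective G hG _ hmk
  refine ⟨R ⧸ Q, inferInstance, { to_finiteDimensional := hf1 }, Ideal.Quotient.mk Q, hf2, ?_⟩
  · intro h0
    rw [Ideal.mem_comap] at ha
    obtain ⟨b, hb⟩ := Ideal.mem_span_singleton.1 ha
    have h2 := hmk a
    rw [hb, map_mul, h0, zero_mul] at h2
    exact ht ((map_eq_zero (algebraMap ℚ (R ⧸ Q))).1 h2.symm)

end Spec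
end UnitEq

namespace UnitEq
section Main
open NumberField Polynomial

/-- homogenized relation -/
def homRel {F : Type*} [CommRing F] (c : F[X]) (N : ℕ) (x y : F) : Prop :=
  ∑ i ∈ Finset.range (N + 1), c.coeff i * (1 - y) ^ i * (x - y) ^ (N - i) =
    x * (1 - y) * (x - y) ^ (N - 1)

lemma homRel_iff {F : Type*} [Field F] (c : F[X]) (N : ℕ) (hN : c.natDegree ≤ N) (h1 : 1 ≤ N)
    (x y l : F) (hxy : x ≠ y) (hl : l * (x - y) = 1 - y) :
    homRel c N x y ↔ l * x = c.eval l := by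
  have hd : (x - y) ^ N ≠ 0 := pow_ne_zero _ (sub_ne_zero.2 hxy)
  unfold homRel
  have e1 : ∑ i ∈ Finset.range (N + 1), c.coeff i * (1 - y) ^ i * (x - y) ^ (N - i) =
      c.eval l * (x - y) ^ N := by
    rw [eval_eq_sum_range' (Nat.lt_succ_of_le hN), Finset.sum_mul]
    refine Finset.sum_congr rfl fun i hi => ?_
    have hi' : i ≤ N := by simpa [Nat.lt_succ_iff] using hi
    rw [← hl, mul_pow]
    calc _ = c.coeff i * l ^ i * ((x - y) ^ i * (x - y) ^ (N - i)) := by ring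
      _ = _ := by rw [← pow_add, Nat.add_sub_cancel' hi']
  have e2 : x * (1 - y) * (x - y) ^ (N - 1) = (l * x) * (x - y) ^ N := by
    obtain ⟨k, rfl⟩ : ∃ k, N = k + 1 := ⟨N - 1, by omega⟩
    rw [← hl]; simp only [Nat.add_sub_cancel]; ring
  rw [e1, e2]
  constructor
  · intro h; exact (mul_right_cancel₀ hd h).symm
  · intro h; rw [h]

lemma homRel_map {F L : Type*} [CommRing F] [CommRing L] (φ : F →+* L) (c : F[X]) (N : ℕ) (x y : F)
    (h : homRel c N x y) : homRel (c.map φ) N (φ x) (φ y) := by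
  have := congrArg φ h
  simpa [homRel, map_sum] using this

lemma homRel_of_map {F L : Type*} [CommRing F] [CommRing L] (φ : F →+* L)
    (hφ : Function.Injective φ) (c : F[X]) (N : ℕ) (x y : F)
    (h : homRel (c.map φ) N (φ x) (φ y)) : homRel c N x y := by
  apply hφ
  simpa [homRel, map_sum] using h

lemma homRel_diag {F : Type*} [Field F] (c : F[X]) (N : ℕ) (hN1 : 1 ≤ N)
    (hN : 2 ≤ N → c.coeff N ≠ 0) (y : F) (hy : y ≠ 1) (h : homRel c N y y) : y = c.coeff 1 := by
  have h1 : 1 - y ≠ 0 := sub_ne_zero.2 hy.symm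
  unfold homRel at h
  rw [Finset.sum_range_succ, Finset.sum_eq_zero, zero_add, Nat.sub_self, pow_zero, mul_one,
    sub_self] at h
  · rcases Nat.lt_or_ge 1 N with h2 | h2
    · rw [zero_pow (by omega), mul_zero] at h
      exact absurd h (mul_ne_zero (hN h2) (pow_ne_zero _ h1))
    · obtain rfl : N = 1 := le_antisymm h2 hN1
      simp only [pow_one, Nat.sub_self, pow_zero, mul_one] at h
      exact (mul_right_cancel₀ h1 h).symm
  · intro i hi
    rw [Finset.mem_range] at hi
    rw [sub_self, zero_pow (by omega), mul_zero]

lemma pow_inj_of_nontorsion {F : Type*} [Field F] {a : F} (ha : a ≠ 0)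
    (h : ∀ k : ℕ, 1 ≤ k → a ^ k ≠ 1) {m n : ℕ} (e : a ^ m = a ^ n) : m = n := by
  wlog hmn : m ≤ n generalizing m n
  · exact (this e.symm (by omega)).symm
  by_contra hne
  obtain ⟨k, rfl⟩ := Nat.exists_eq_add_of_le hmn
  apply h k (by omega)
  rw [pow_add] at e
  exact (mul_left_cancel₀ (pow_ne_zero m ha) (by rw [mul_one]; exact e)).symm

theorem pairs_finite_nf {K : Type} [Field K] [NumberField K] (a d : K) (ha : a ≠ 0) (hd : d ≠ 0)
    (hat : ∀ k : ℕ, 1 ≤ k → a ^ k ≠ 1) (hdt : ∀ k : ℕ, 1 ≤ k → d ^ k ≠ 1) (c : K[X])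
    (h1 : ¬ (c.natDegree ≤ 1 ∧ c.coeff 0 = 0))
    (h2 : ¬ (c.natDegree ≤ 1 ∧ c.coeff 1 + c.coeff 0 = 1))
    (h3 : ¬ (c.natDegree ≤ 1 ∧ c.coeff 0 = 1 ∧ c.coeff 1 = -1)) :
    {p : ℕ × ℕ | 1 ≤ p.1 ∧ 1 ≤ p.2 ∧ homRel c (max 1 c.natDegree) (a ^ p.1) (d ^ p.2)}.Finite := by
  set N := max 1 c.natDegree with hN
  have hN1 : 1 ≤ N := le_max_left _ _
  have hNd : c.natDegree ≤ N := le_max_right _ _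
  have hexc : {p : ℕ × ℕ | a ^ p.1 = c.coeff 1 ∧ d ^ p.2 = c.coeff 1}.Finite := by
    apply Set.Subsingleton.finite
    rintro ⟨m, n⟩ ⟨e1, e2⟩ ⟨m', n'⟩ ⟨e3, e4⟩
    simp only at e1 e2 e3 e4
    rw [pow_inj_of_nontorsion ha hat (e1.trans e3.symm), pow_inj_of_nontorsion hd hdt (e2.trans e4.symm)]
  set P := {p : ℕ × ℕ | 1 ≤ p.1 ∧ 1 ≤ p.2 ∧ homRel c N (a ^ p.1) (d ^ p.2)} with hP
  have key : ∀ p ∈ P \ {p : ℕ × ℕ | a ^ p.1 = c.coeff 1 ∧ d ^ p.2 = c.coeff 1},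
      ∀ l, l = (1 - d ^ p.2) / (a ^ p.1 - d ^ p.2) →
      l ≠ 0 ∧ l ≠ 1 ∧ l * a ^ p.1 = c.eval l ∧ (l - 1) * d ^ p.2 = c.eval l - 1 := by
    rintro ⟨m, n⟩ ⟨⟨hm, hn, hr⟩, hne⟩ l hl
    simp only [Set.mem_ofPred_eq] at *
    have hxy : a ^ m ≠ d ^ n := by
      intro e
      rw [e] at hr
      have := homRel_diag c N hN1 (fun h => by
        have e : N = c.natDegree := by omega
        rw [e]
        refine leadingCoeff_ne_zero.2 ?_
        rintro rfl
        simp at e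
        omega) _ (hdt n hn) hr
      exact hne ⟨e.trans this, this⟩
    have hxy' := sub_ne_zero.2 hxy
    have hl' : l * (a ^ m - d ^ n) = 1 - d ^ n := by rw [hl]; field_simp
    have e := (homRel_iff c N hNd hN1 _ _ l hxy hl').1 hr
    refine ⟨?_, ?_, e, ?_⟩
    · rintro rfl
      apply hdt n hn
      linear_combination hl'
    · rintro rfl
      apply hat m hm
      linear_combination hl'
    · rw [← e]; linear_combination -hl'
  have hfin : (P \ {p : ℕ × ℕ | a ^ p.1 = c.coeff 1 ∧ d ^ p.2 = c.coeff 1}).Finite := by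
    refine Set.Finite.of_injOn (f := fun p : ℕ × ℕ => (1 - d ^ p.2) / (a ^ p.1 - d ^ p.2)) ?_ ?_
      (curve_finite a d ha hd c h1 h2 h3)
    · intro p hp
      obtain ⟨k1, k2, k3, k4⟩ := key p hp _ rfl
      exact ⟨k1, k2, p.1, p.2, k3, k4⟩
    · intro p hp q hq hpq
      obtain ⟨k1, k2, k3, k4⟩ := key p hp _ rfl
      obtain ⟨-, -, j3, j4⟩ := key q hq _ hpq
      simp only at *
      refine Prod.ext ?_ ?_
      · exact pow_inj_of_nontorsion ha hat (mul_left_cancel₀ k1 (k3.trans j3.symm))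
      · exact pow_inj_of_nontorsion hd hdt (mul_left_cancel₀ (sub_ne_zero.2 k2) (k4.trans j4.symm))
  exact (hfin.union hexc).subset fun p hp => by
    by_cases h : a ^ p.1 = c.coeff 1 ∧ d ^ p.2 = c.coeff 1
    · exact Or.inr h
    · exact Or.inl ⟨hp, h⟩

lemma exists_witness {R : Type} [CommRing R] [IsDomain R] (c : R[X])
    (h1 : ¬ (c.natDegree ≤ 1 ∧ c.coeff 0 = 0))
    (h2 : ¬ (c.natDegree ≤ 1 ∧ c.coeff 1 + c.coeff 0 = 1))
    (h3 : ¬ (c.natDegree ≤ 1 ∧ c.coeff 0 = 1 ∧ c.coeff 1 = -1)) :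
    ∃ w : R, w ≠ 0 ∧ ∀ (K : Type) [Field K] (φ : R →+* K), φ w ≠ 0 →
      (c.map φ).natDegree = c.natDegree ∧
      ¬ ((c.map φ).natDegree ≤ 1 ∧ (c.map φ).coeff 0 = 0) ∧
      ¬ ((c.map φ).natDegree ≤ 1 ∧ (c.map φ).coeff 1 + (c.map φ).coeff 0 = 1) ∧
      ¬ ((c.map φ).natDegree ≤ 1 ∧ (c.map φ).coeff 0 = 1 ∧ (c.map φ).coeff 1 = -1) := by
  have hc0 : c ≠ 0 := by rintro rfl; simp at h1
  have hlc := leadingCoeff_ne_zero.2 hc0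
  rcases Nat.lt_or_ge 1 c.natDegree with hd | hd
  · refine ⟨c.leadingCoeff, hlc, fun K _ φ hφ => ?_⟩
    have e := natDegree_map_of_leadingCoeff_ne_zero φ hφ
    rw [e]
    refine ⟨rfl, ?_, ?_, ?_⟩ <;> (rintro ⟨h, -⟩; omega)
  · have a1 : c.coeff 0 ≠ 0 := fun h => h1 ⟨hd, h⟩
    have a2 : c.coeff 1 + c.coeff 0 - 1 ≠ 0 := fun h => h2 ⟨hd, sub_eq_zero.1 h⟩
    obtain ⟨u, hu0, hu⟩ : ∃ u : R, u ≠ 0 ∧ (u = c.coeff 0 - 1 ∨ u = c.coeff 1 + 1) := by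
      by_cases h : c.coeff 0 = 1
      · refine ⟨_, ?_, Or.inr rfl⟩
        intro h'
        exact h3 ⟨hd, h, by linear_combination h'⟩
      · exact ⟨_, sub_ne_zero.2 h, Or.inl rfl⟩
    refine ⟨c.leadingCoeff * (c.coeff 0 * ((c.coeff 1 + c.coeff 0 - 1) * u)),
      mul_ne_zero hlc (mul_ne_zero a1 (mul_ne_zero a2 hu0)), fun K _ φ hφ => ?_⟩
    simp only [map_mul, ne_eq, mul_eq_zero, not_or] at hφ
    obtain ⟨b1, b2, b3, b4⟩ := hφ
    have e := natDegree_map_of_leadingCoeff_ne_zero φ b1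
    simp only [e, coeff_map]
    refine ⟨trivial, fun h => b2 h.2, fun h => b3 ?_, fun h => b4 ?_⟩
    · rw [map_sub, map_add, h.2, map_one, sub_self]
    · rcases hu with rfl | rfl
      · rw [map_sub, h.2.1, map_one, sub_self]
      · rw [map_add, h.2.2, map_one]; ring

theorem main_normalized (α δ : ℂ) (hα : α ≠ 0) (hδ : δ ≠ 0)
    (hat : ∀ k : ℕ, 1 ≤ k → α ^ k ≠ 1) (hdt : ∀ k : ℕ, 1 ≤ k → δ ^ k ≠ 1) (c : ℂ[X])
    (h1 : ¬ (c.natDegree ≤ 1 ∧ c.coeff 0 = 0))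
    (h2 : ¬ (c.natDegree ≤ 1 ∧ c.coeff 1 + c.coeff 0 = 1))
    (h3 : ¬ (c.natDegree ≤ 1 ∧ c.coeff 0 = 1 ∧ c.coeff 1 = -1)) :
    {l : ℂ | ∃ m n : ℕ, 1 ≤ m ∧ 1 ≤ n ∧ l * α ^ m = c.eval l ∧
      (l - 1) * δ ^ n = c.eval l - 1}.Finite := by
  classical
  let S : Finset ℂ := {α, δ} ∪ c.coeffs
  let R := Algebra.adjoin ℚ (S : Set ℂ)
  have : Algebra.FiniteType ℚ R := Subalgebra.fg_iff_finiteType _ |>.1 ⟨S, rfl⟩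
  let j : R →+* ℂ := algebraMap R ℂ
  have hj : Function.Injective j := Subtype.val_injective
  have hS : ∀ z ∈ S, ∃ r : R, j r = z := fun z hz => ⟨⟨z, Algebra.subset_adjoin hz⟩, rfl⟩
  obtain ⟨a, ha⟩ := hS α (by simp [S])
  obtain ⟨d, hd⟩ := hS δ (by simp [S])
  obtain ⟨cR, hcR⟩ : ∃ cR : R[X], cR.map j = c := by
    have : c ∈ Polynomial.lifts j := by
      rw [lifts_iff_coeff_lifts]
      intro i
      by_cases h : c.coeff i = 0
      · exact ⟨0, by rw [h, map_zero]⟩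
      · exact hS _ (Finset.mem_union_right _ (coeff_mem_coeffs h))
    exact this
  have hdeg : c.natDegree = cR.natDegree := by
    rw [← hcR]; exact natDegree_map_eq_of_injective hj cR
  have hco : ∀ i, c.coeff i = j (cR.coeff i) := fun i => by rw [← hcR, coeff_map]
  obtain ⟨w, hw0, hw⟩ := exists_witness cR
    (by rintro ⟨u, v⟩; exact h1 ⟨hdeg ▸ u, by rw [hco, v, map_zero]⟩)
    (by rintro ⟨u, v⟩; exact h2 ⟨hdeg ▸ u, by rw [hco, hco, ← map_add, v, map_one]⟩)
    (by rintro ⟨u, v, v'⟩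
        exact h3 ⟨hdeg ▸ u, by rw [hco, v, map_one], by rw [hco, v', map_neg, map_one]⟩)
  obtain ⟨D, hD⟩ := exists_spec R
  set M := (2 * D).factorial with hM
  have hM1 : 1 ≤ M := Nat.factorial_pos _
  have ha0 : a ≠ 0 := by rintro rfl; exact hα (by rw [← ha, map_zero])
  have hd0 : d ≠ 0 := by rintro rfl; exact hδ (by rw [← hd, map_zero])
  have haM : a ^ M - 1 ≠ 0 := by
    intro h
    apply hat M hM1
    rw [← ha, ← map_pow, sub_eq_zero.1 h, map_one]
  have hdM : d ^ M - 1 ≠ 0 := by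
    intro h
    apply hdt M hM1
    rw [← hd, ← map_pow, sub_eq_zero.1 h, map_one]
  obtain ⟨K, _, _, φ, hfr, hφ⟩ := hD (a * (d * ((a ^ M - 1) * ((d ^ M - 1) * w))))
    (mul_ne_zero ha0 (mul_ne_zero hd0 (mul_ne_zero haM (mul_ne_zero hdM hw0))))
  simp only [map_mul, ne_eq, mul_eq_zero, not_or] at hφ
  obtain ⟨b1, b2, b3, b4, b5⟩ := hφ
  obtain ⟨g0, g1, g2, g3⟩ := hw K φ b5
  have hat' : ∀ k : ℕ, 1 ≤ k → φ a ^ k ≠ 1 := by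
    intro k hk h
    apply b3
    rw [map_sub, map_pow, torsion_bound D hfr _ k hk h, map_one, sub_self]
  have hdt' : ∀ k : ℕ, 1 ≤ k → φ d ^ k ≠ 1 := by
    intro k hk h
    apply b4
    rw [map_sub, map_pow, torsion_bound D hfr _ k hk h, map_one, sub_self]
  have hfin := pairs_finite_nf (φ a) (φ d) b1 b2 hat' hdt' (cR.map φ) g1 g2 g3
  refine (hfin.image fun p : ℕ × ℕ => (1 - δ ^ p.2) / (α ^ p.1 - δ ^ p.2)).subset ?_
  rintro l ⟨m, n, hm, hn, e1, e2⟩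
  have e3 : l * (α ^ m - δ ^ n) = 1 - δ ^ n := by linear_combination e1 - e2
  have hxy : α ^ m ≠ δ ^ n := by
    intro h
    rw [h, sub_self, mul_zero] at e3
    exact hdt n hn (sub_eq_zero.1 e3.symm).symm
  have hxy' := sub_ne_zero.2 hxy
  refine ⟨(m, n), ⟨hm, hn, ?_⟩, ?_⟩
  · have r1 : homRel c (max 1 c.natDegree) (α ^ m) (δ ^ n) :=
      (homRel_iff c _ (le_max_right _ _) (le_max_left _ _) _ _ l hxy e3).2 e1
    rw [hdeg, ← hcR, ← ha, ← hd, ← map_pow, ← map_pow] at r1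
    have r2 := homRel_map φ _ _ _ _ (homRel_of_map j hj _ _ _ _ r1)
    rw [map_pow, map_pow] at r2
    rw [g0]
    exact r2
  · simp only
    rw [← e3]; field_simp

end Main
end UnitEq

namespace UnitEq
section Final
open Polynomial

lemma word_append (f g : ℂ → ℂ) (w₁ w₂ : List Bool) :
    ((w₁ ++ w₂).map fun b => if b then f else g).foldr (· ∘ ·) id =
      (w₁.map fun b => if b then f else g).foldr (· ∘ ·) id ∘
      (w₂.map fun b => if b then f else g).foldr (· ∘ ·) id := by
  induction w₁ with
  | nil => rfl
  | cons a t ih =>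
    simp only [List.cons_append, List.map_cons, List.foldr_cons]
    rw [ih]; rfl

lemma word_rep (f g : ℂ → ℂ) (b : Bool) (n : ℕ) :
    ((List.replicate n b).map fun b => if b then f else g).foldr (· ∘ ·) id =
      (if b then f else g)^[n] := by
  induction n with
  | zero => rfl
  | succ n ih =>
    rw [List.replicate_succ, List.map_cons, List.foldr_cons, ih, Function.iterate_succ']

lemma iter_affine {α β p : ℂ} (hp : α * p + β = p) {f : ℂ → ℂ} (hf : ∀ x, f x = α * x + β)
    (m : ℕ) (x : ℂ) : f^[m] x = α ^ m * (x - p) + p := by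
  induction m with
  | zero => simp
  | succ n ih =>
    rw [Function.iterate_succ_apply', ih, hf, pow_succ]
    linear_combination hp

lemma eval_iter (α β : ℂ) {f : ℂ → ℂ} (hf : ∀ x, f x = α * x + β) (m : ℕ) (x : ℂ) :
    (((fun q : ℂ[X] => q.comp (C α * X + C β))^[m]) X).eval x = f^[m] x := by
  induction m generalizing x with
  | zero => simp
  | succ n ih =>
    rw [Function.iterate_succ_apply', Function.iterate_succ_apply, ← ih, eval_comp, hf]
    simp

/-- torsion multiplier gives a relation -/
lemma torsion_words (f g : ℂ → ℂ) (b : Bool) (k : ℕ) (hk : 1 ≤ k)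
    (h : (if b then f else g)^[k] = id) :
    ∃ w₁ w₂ : List Bool, w₁ ≠ [] ∧ w₂ ≠ [] ∧ w₁ ≠ w₂ ∧
      (w₁.map fun b => if b then f else g).foldr (· ∘ ·) id =
      (w₂.map fun b => if b then f else g).foldr (· ∘ ·) id := by
  refine ⟨List.replicate k b, List.replicate (k + k) b, ?_, ?_, ?_, ?_⟩
  · intro e; have := congrArg List.length e; simp at this; omega
  · intro e; have := congrArg List.length e; simp at this; omega
  · intro e; have := congrArg List.length e; simp at this; omega
  · rw [word_rep, word_rep, Function.iterate_add, h]; rfl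

end Final
end UnitEq

/-- Corollary 2.11: infinitely many common solutions force non-freeness. -/
theorem stmt8 (α δ β γ : ℂ) (hα : α ≠ 0) (hδ : δ ≠ 0) (hα1 : α ≠ 1) (hδ1 : δ ≠ 1)
    (f g : ℂ → ℂ)
    (hf : ∀ x, f x = α * x + β) (hg : ∀ x, g x = δ * x + γ)
    (c : Polynomial ℂ)
    (hcf : ∀ m : ℕ, 1 ≤ m →
      c ≠ (fun q : Polynomial ℂ =>
        q.comp (Polynomial.C α * Polynomial.X + Polynomial.C β))^[m] Polynomial.X)
    (hcg : ∀ n : ℕ, 1 ≤ n →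
      c ≠ (fun q : Polynomial ℂ =>
        q.comp (Polynomial.C δ * Polynomial.X + Polynomial.C γ))^[n] Polynomial.X)
    (hinf : {l : ℂ | ∃ m n : ℕ, 1 ≤ m ∧ 1 ≤ n ∧
        f^[m] l = g^[n] l ∧ g^[n] l = c.eval l}.Infinite) :
    ∃ w₁ w₂ : List Bool, w₁ ≠ [] ∧ w₂ ≠ [] ∧ w₁ ≠ w₂ ∧
      (w₁.map fun b => if b then f else g).foldr (· ∘ ·) id =
      (w₂.map fun b => if b then f else g).foldr (· ∘ ·) id := by
  classical
  by_cases hat : ∀ k : ℕ, 1 ≤ k → α ^ k ≠ 1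
  swap
  · push Not at hat
    obtain ⟨k, hk, e⟩ := hat
    refine UnitEq.torsion_words f g true k hk ?_
    have h1 : 1 - α ≠ 0 := sub_ne_zero.2 hα1.symm
    funext x
    have := UnitEq.iter_affine (p := β / (1 - α)) (by field_simp; ring) hf k x
    simpa [e] using this
  by_cases hdt : ∀ k : ℕ, 1 ≤ k → δ ^ k ≠ 1
  swap
  · push Not at hdt
    obtain ⟨k, hk, e⟩ := hdt
    refine UnitEq.torsion_words f g false k hk ?_
    have h1 : 1 - δ ≠ 0 := sub_ne_zero.2 hδ1.symm
    funext x
    have := UnitEq.iter_affine (p := γ / (1 - δ)) (by field_simp; ring) hg k x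
    simpa [e] using this
  obtain ⟨p, hp⟩ : ∃ p, α * p + β = p := by
    have h1 : 1 - α ≠ 0 := sub_ne_zero.2 hα1.symm
    exact ⟨β / (1 - α), by field_simp; ring⟩
  obtain ⟨q, hq⟩ : ∃ q, δ * q + γ = q := by
    have h1 : 1 - δ ≠ 0 := sub_ne_zero.2 hδ1.symm
    exact ⟨γ / (1 - δ), by field_simp; ring⟩
  have hfi := UnitEq.iter_affine hp hf
  have hgi := UnitEq.iter_affine hq hg
  by_cases hpq : p = q
  · refine ⟨[true, false], [false, true], by simp, by simp, by simp, ?_⟩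
    funext x
    simp only [List.map_cons, List.map_nil, List.foldr_cons, List.foldr_nil, if_true,
      Function.comp_apply, id, Bool.false_eq_true, if_false, hf, hg]
    subst hpq
    linear_combination (1 - δ) * hp - (1 - α) * hq
  have hqp : q - p ≠ 0 := sub_ne_zero.2 (Ne.symm hpq)
  set d : Polynomial ℂ := Polynomial.C (q - p)⁻¹ *
    (c.comp (Polynomial.C p + Polynomial.C (q - p) * Polynomial.X) - Polynomial.C p) with hd
  have hde : ∀ z, d.eval z = (c.eval (p + (q - p) * z) - p) / (q - p) := by
    intro z
    simp only [hd, Polynomial.eval_mul, Polynomial.eval_sub, Polynomial.eval_C,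
      Polynomial.eval_comp, Polynomial.eval_add, Polynomial.eval_X]
    field_simp
  have hce : ∀ x, c.eval x = p + (q - p) * d.eval ((x - p) / (q - p)) := by
    intro x
    rw [hde]
    have : p + (q - p) * ((x - p) / (q - p)) = x := by field_simp; ring
    rw [this]; field_simp; ring
  -- transported solutions
  have hsol : ∀ l m n, f^[m] l = g^[n] l → g^[n] l = c.eval l →
      (l - p) / (q - p) * α ^ m = d.eval ((l - p) / (q - p)) ∧
      ((l - p) / (q - p) - 1) * δ ^ n = d.eval ((l - p) / (q - p)) - 1 := by
    intro l m n e1 e2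
    have e3 := e1.trans e2
    rw [hfi, hce l] at e3
    rw [hgi, hce l] at e2
    constructor
    · field_simp
      linear_combination e3
    · field_simp
      linear_combination e2
  have hlin : d.natDegree ≤ 1 → ∀ z, d.eval z = d.coeff 1 * z + d.coeff 0 := by
    intro h z
    conv_lhs => rw [Polynomial.eq_X_add_C_of_natDegree_le_one h]
    simp
  obtain ⟨l, ⟨m, n, hm, hn, e1, e2⟩, hl⟩ := hinf.exists_notMem_finite (Set.toFinite {p, q})
  simp only [Set.mem_insert_iff, Set.mem_singleton_iff, not_or] at hl
  obtain ⟨s1, s2⟩ := hsol l m n e1 e2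
  have hz0 : (l - p) / (q - p) ≠ 0 := div_ne_zero (sub_ne_zero.2 hl.1) hqp
  have hz1 : (l - p) / (q - p) - 1 ≠ 0 := by
    intro h
    apply hl.2
    field_simp at h
    linear_combination h
  generalize (l - p) / (q - p) = z at *
  by_cases h1 : d.natDegree ≤ 1 ∧ d.coeff 0 = 0
  · exfalso
    have hk : α ^ m = d.coeff 1 := by
      rw [hlin h1.1, h1.2] at s1
      exact mul_left_cancel₀ hz0 (by linear_combination s1)
    apply hcf m hm
    refine Polynomial.funext fun x => ?_
    rw [UnitEq.eval_iter α β hf, hfi, hce, hlin h1.1, h1.2, ← hk]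
    field_simp
    ring
  by_cases h2 : d.natDegree ≤ 1 ∧ d.coeff 1 + d.coeff 0 = 1
  · exfalso
    have hk : δ ^ n = d.coeff 1 := by
      rw [hlin h2.1] at s2
      exact mul_left_cancel₀ hz1 (by linear_combination s2 + h2.2)
    apply hcg n hn
    refine Polynomial.funext fun x => ?_
    have h3 : d.coeff 0 = 1 - d.coeff 1 := by linear_combination h2.2
    rw [UnitEq.eval_iter δ γ hg, hgi, hce, hlin h2.1, h3, ← hk]
    field_simp
    ring
  by_cases h3 : d.natDegree ≤ 1 ∧ d.coeff 0 = 1 ∧ d.coeff 1 = -1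
  · rw [hlin h3.1, h3.2.1, h3.2.2] at s1 s2
    have hprod : α ^ m * δ ^ n = 1 := by
      apply mul_left_cancel₀ (mul_ne_zero hz0 hz1)
      linear_combination (z - 1) * δ ^ n * s1 + (1 - z) * s2
    refine ⟨List.replicate m true ++ (List.replicate n false ++
        (List.replicate n false ++ List.replicate m true)),
      List.replicate n false ++ (List.replicate m true ++
        (List.replicate m true ++ List.replicate n false)), ?_, ?_, ?_, ?_⟩
    · intro e; have := congrArg List.length e; simp at this; omega
    · intro e; have := congrArg List.length e; simp at this; omega
    · obtain ⟨m', rfl⟩ : ∃ k, m = k + 1 := ⟨m - 1, by omega⟩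
      obtain ⟨n', rfl⟩ : ∃ k, n = k + 1 := ⟨n - 1, by omega⟩
      simp [List.replicate_succ]
    · simp only [UnitEq.word_append, UnitEq.word_rep]
      funext x
      simp only [Function.comp_apply, if_true, Bool.false_eq_true, if_false, hfi, hgi]
      generalize α ^ m = A at *
      generalize δ ^ n = B at *
      linear_combination (p - q) * (A + B - A * B - 1) * hprod
  · exfalso
    apply hinf
    have hfin := UnitEq.main_normalized α δ hα hδ hat hdt d h1 h2 h3
    refine (hfin.image fun z => p + (q - p) * z).subset ?_
    rintro l' ⟨m', n', hm', hn', e1', e2'⟩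
    obtain ⟨t1, t2⟩ := hsol l' m' n' e1' e2'
    refine ⟨(l' - p) / (q - p), ⟨m', n', hm', hn', t1, t2⟩, ?_⟩
    simp only
    field_simp
    ring
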